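/- Failure of the bilinear estimate for the second derivative of the spinor flow: let s < 1/4 and T > 0. Then there is no constant C such that sup_{0≤t≤T} ‖G(t)‖_{H^s} ≤ C‖a₀‖_{H^s}‖ψ₀‖_{H^s} holds for all a₀ ∈ H^s(ℝ²;ℝ) and ψ₀ ∈ H^s(ℝ²;ℂ²), where G(t) = Σ over sign choices ±₁,±₂,±₃ of ∫₀ᵗ U_{±₁}(t−t') Π_{±₁}( A^{hom}_{μ,±₂}(t') α^μ U_{±₃}(t')ψ₀ ) dt' with A^{hom}_{0,±}(t) = (1/2)U_±(t)a₀ and A^{hom}_{j,±}(t) = ∓(1/2)U_±(t)(∂_j/(iD))a₀ for j = 1,2 (summation over μ ∈ {0,1,2}). -/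

import Mathlib

noncomputable section
open MeasureTheory Complex InnerProductGeometry
open scoped ENNReal FourierTransform

/-- Physical space `ℝ²`. -/
abbrev Rd2 : Type := EuclideanSpace ℝ (Fin 2)
/-- Space-time `ℝ^{1+2}`, coordinates `X 0 = τ (or t)`, `(X 1, X 2) = ξ (or x)`. -/
abbrev Rst : Type := EuclideanSpace ℝ (Fin 3)
/-- Spinor space `ℂ²`. -/
abbrev Spinor : Type := EuclideanSpace ℂ (Fin 2)

/-- Pauli matrix σ¹. -/
def sigma1 : Matrix (Fin 2) (Fin 2) ℂ := !![0, 1; 1, 0]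
/-- Pauli matrix σ². -/
def sigma2 : Matrix (Fin 2) (Fin 2) ℂ := !![0, -Complex.I; Complex.I, 0]
/-- Pauli matrix σ³. -/
def sigma3 : Matrix (Fin 2) (Fin 2) ℂ := !![1, 0; 0, -1]
/-- Dirac matrices `α⁰ = I, α¹ = σ¹, α² = σ²`. -/
def alphaM : Fin 3 → Matrix (Fin 2) (Fin 2) ℂ := ![1, sigma1, sigma2]

/-- A 2×2 complex matrix acting on a spinor. -/
def mulVecE (M : Matrix (Fin 2) (Fin 2) ℂ) (v : Spinor) : Spinor :=
  (EuclideanSpace.equiv (Fin 2) ℂ).symm (fun i => ∑ j, M i j * v j)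

/-- `v† w` for spinors. -/
def pairD (v w : Spinor) : ℂ := ∑ i, (starRingEnd ℂ) (v i) * w i

/-- The totally skew-symmetric tensor with `ε₀₁₂ = 1`. -/
def eps (a b c : Fin 3) : ℝ :=
  ((b.val : ℝ) - (a.val : ℝ)) * ((c.val : ℝ) - (b.val : ℝ)) * ((c.val : ℝ) - (a.val : ℝ)) / 2

/-- value of a sign represented by a Bool: `true ↦ +1`, `false ↦ -1`. -/
def sv (b : Bool) : ℝ := if b then 1 else -1

/-- Dyadic Littlewood–Paley condition: the `k`-th dyadic block (`N = 2^k`); the lowest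
block `k = 0` captures `{|ξ| < 2}`. -/
def LPcond (k : ℕ) (r : ℝ) : Prop := if k = 0 then r < 2 else (2:ℝ)^k ≤ r ∧ r < 2^(k+1)

/-- The `k`-th Littlewood–Paley frequency annulus in `ℝ²`. -/
def LPset (k : ℕ) : Set Rd2 := {ξ | LPcond k ‖ξ‖}

/-- `‖P_N f‖_{L²}` for `N = 2^k`, computed on the Fourier side (Plancherel). -/
def LPnorm {E : Type*} [NormedAddCommGroup E] [NormedSpace ℂ E] (k : ℕ) (f : Rd2 → E) : ℝ≥0∞ :=
  eLpNorm ((LPset k).indicator (𝓕 f)) 2 volume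

/-- Sobolev `H^s` norm, `‖f‖_{H^s} = (Σ_{dyadic N ≥ 1} N^{2s} ‖P_N f‖²_{L²})^{1/2}`. -/
def sobNorm {E : Type*} [NormedAddCommGroup E] [NormedSpace ℂ E] (s : ℝ) (f : Rd2 → E) : ℝ≥0∞ :=
  (∑' k : ℕ, (2:ℝ≥0∞) ^ (2 * s * (k:ℝ)) * (LPnorm k f)^2) ^ (1/2 : ℝ)

/-- Besov `B^s_{2,1}` norm, `‖f‖ = Σ_{dyadic N ≥ 1} N^s ‖P_N f‖_{L²}`. -/
def besovNorm {E : Type*} [NormedAddCommGroup E] [NormedSpace ℂ E] (s : ℝ) (f : Rd2 → E) : ℝ≥0∞ :=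
  ∑' k : ℕ, (2:ℝ≥0∞) ^ (s * (k:ℝ)) * LPnorm k f

/-- Fourier multiplier on `ℝ²` with symbol `m`. -/
def fmul {E : Type*} [NormedAddCommGroup E] [NormedSpace ℂ E] (m : Rd2 → ℂ) (f : Rd2 → E) :
    Rd2 → E := 𝓕⁻ (fun ξ => m ξ • 𝓕 f ξ)

/-- Half-wave propagator `U_±(t) = e^{∓itD}` (`sg = ±1`), `D = |∇|` the multiplier with
symbol `|ξ|`. -/
def Uop {E : Type*} [NormedAddCommGroup E] [NormedSpace ℂ E] (sg t : ℝ) (f : Rd2 → E) :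
    Rd2 → E := fmul (fun ξ => Complex.exp (-Complex.I * ((sg * t * ‖ξ‖ : ℝ) : ℂ))) f

/-- spatial index of a nonzero space-time index. -/
def sIdx (j : Fin 3) : Fin 2 := if j = 1 then 0 else 1

/-- Symbols of the modified Riesz transforms: `r⁰_± = -1`, `r^j_± = ∓ξ_j/|ξ|`. -/
def rsym (sg : ℝ) (μ : Fin 3) (ξ : Rd2) : ℂ :=
  if μ = 0 then -1 else ((-(sg * ξ (sIdx μ)) / ‖ξ‖ : ℝ) : ℂ)

/-- Modified Riesz transform `R^μ_±` as a Fourier multiplier on `ℝ²`. -/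
def riesz {E : Type*} [NormedAddCommGroup E] [NormedSpace ℂ E] (sg : ℝ) (μ : Fin 3)
    (f : Rd2 → E) : Rd2 → E := fmul (rsym sg μ) f

/-- Symbol of the Dirac projection `Π_±(ξ) = (1/2)(I ± ξ_jα^j/|ξ|)`. -/
def PiSym (sg : ℝ) (ξ : Rd2) : Matrix (Fin 2) (Fin 2) ℂ :=
  (1/2 : ℂ) • (1 + ((sg / ‖ξ‖ : ℝ) : ℂ) • (((ξ 0 : ℝ) : ℂ) • sigma1 + ((ξ 1 : ℝ) : ℂ) • sigma2))

/-- Dirac projection `Π_±` acting as a Fourier multiplier on spinor fields over `ℝ²`. -/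
def PiOp (sg : ℝ) (ψ : Rd2 → Spinor) : Rd2 → Spinor :=
  𝓕⁻ (fun ξ => mulVecE (PiSym sg ξ) (𝓕 ψ ξ))
/-- The homogeneous half-wave parts of the gauge potential generated by the datum `a₀`:
`A^{hom}_{0,±}(t) = (1/2)U_±(t)a₀`, `A^{hom}_{j,±}(t) = ∓(1/2)U_±(t)(∂_j/(iD))a₀`. -/
def Ahom (sg : ℝ) (a0 : Rd2 → ℂ) (μ : Fin 3) (t : ℝ) : Rd2 → ℂ :=
  if μ = 0 then fun x => (1/2 : ℂ) * Uop sg t a0 x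
  else fun x => -(sg : ℂ) * (1/2 : ℂ) *
    Uop sg t (fmul (fun ξ => (Complex.I * ((ξ (sIdx μ) : ℝ) : ℂ)) / (Complex.I * (‖ξ‖ : ℂ))) a0) x

/-- The mixed second derivative of the spinor flow at the origin:
`G(t) = Σ_{±₁,±₂,±₃} ∫₀ᵗ U_{±₁}(t−t') Π_{±₁}(A^{hom}_{μ,±₂}(t') α^μ U_{±₃}(t')ψ₀) dt'`. -/
def Gflow (a0 : Rd2 → ℂ) (ψ0 : Rd2 → Spinor) (t : ℝ) : Rd2 → Spinor := fun x =>
  ∑ s1 : Bool, ∑ s2 : Bool, ∑ s3 : Bool, ∫ t' in (0:ℝ)..t,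
    Uop (sv s1) (t - t')
      (PiOp (sv s1)
        (fun y => ∑ μ : Fin 3,
          Ahom (sv s2) a0 μ t' y • mulVecE (alphaM μ) (Uop (sv s3) t' ψ0 y))) x

open scoped ContDiff Convolution Pointwise

section FourierCompact

variable {E : Type*} [NormedAddCommGroup E] [NormedSpace ℂ E]

lemma integrable_fourierInv_of_compactSupport {f : Rd2 → E} (hf : ContDiff ℝ ∞ f)
    (hc : HasCompactSupport f) : Integrable (𝓕⁻ f) := by
  have h := SchwartzMap.integrable (μ := volume) (𝓕⁻ (hc.toSchwartzMap hf) : SchwartzMap Rd2 E)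
  rw [SchwartzMap.fourierInv_coe] at h
  exact h

lemma integrable_fourier_of_compactSupport {f : Rd2 → E} (hf : ContDiff ℝ ∞ f)
    (hc : HasCompactSupport f) : Integrable (𝓕 f) := by
  have h := SchwartzMap.integrable (μ := volume) (𝓕 (hc.toSchwartzMap hf) : SchwartzMap Rd2 E)
  rw [SchwartzMap.fourier_coe] at h
  exact h

lemma fourier_fourierInv_of_compactSupport [CompleteSpace E] {f : Rd2 → E} (hf : ContDiff ℝ ∞ f)
    (hc : HasCompactSupport f) : 𝓕 (𝓕⁻ f) = f :=
  hf.continuous.fourier_fourierInv_eq (hf.continuous.integrable_of_hasCompactSupport hc)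
    (integrable_fourier_of_compactSupport hf hc)

lemma fourier_smul_vec [CompleteSpace E] (f : Rd2 → ℂ) (v : E) (ξ : Rd2) :
    𝓕 (fun x => f x • v) ξ = 𝓕 f ξ • v := by
  rw [Real.fourier_eq', Real.fourier_eq', ← integral_smul_const]
  simp only [smul_assoc]

lemma fourierInv_smul_vec [CompleteSpace E] (f : Rd2 → ℂ) (v : E) (x : Rd2) :
    𝓕⁻ (fun ξ => f ξ • v) x = 𝓕⁻ f x • v := by
  rw [Real.fourierInv_eq', Real.fourierInv_eq', ← integral_smul_const]
  simp only [smul_assoc]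

lemma fourierInv_const_mul (f : Rd2 → ℂ) (c : ℂ) (x : Rd2) :
    𝓕⁻ (fun ξ => c * f ξ) x = c * 𝓕⁻ f x := by
  simp only [Real.fourierInv_eq', ← integral_const_mul, smul_eq_mul]
  congr 1; ext; ring

lemma fourier_finset_sum {ι : Type*} (S : Finset ι) (f : ι → Rd2 → E)
    (hf : ∀ i ∈ S, Integrable (f i)) (x : Rd2) :
    𝓕 (fun ξ => ∑ i ∈ S, f i ξ) x = ∑ i ∈ S, 𝓕 (f i) x := by
  simp only [Real.fourier_eq, Finset.smul_sum]
  rw [integral_finsetSum]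
  intro i hi
  exact (Real.fourierIntegral_convergent_iff x).2 (hf i hi)

/-- Smooth dependence of an integral on parameters, for an integrand whose support in the
integration variable is contained in a fixed compact set. -/
lemma contDiff_integral_of_compactSupport {P X F : Type*} [NormedAddCommGroup P] [NormedSpace ℝ P]
    [NormedAddCommGroup X] [NormedSpace ℝ X] [FiniteDimensional ℝ X] [MeasurableSpace X]
    [BorelSpace X] (μ : Measure X) [μ.IsAddHaarMeasure]
    [NormedAddCommGroup F] [NormedSpace ℝ F] [CompleteSpace F]
    {f : X → ℝ} (hf : LocallyIntegrable f μ) {g : P → X → F} {k : Set X} (hk : IsCompact k)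
    (hgk : ∀ p, ∀ x ∉ k, g p x = 0) (hg : ContDiff ℝ ∞ (fun q : P × X => g q.1 q.2)) :
    ContDiff ℝ ∞ (fun p => ∫ x, f x • g p x ∂μ) := by
  have h := contDiffOn_convolution_right_with_param (𝕜 := ℝ) (μ := μ) (n := ⊤) (f := f)
    (ContinuousLinearMap.lsmul ℝ ℝ) (g := fun (p : P) x => g p (-x)) (s := Set.univ)
    (k := -k) isOpen_univ hk.neg (fun p x _ hx => hgk p _ (by simpa using hx)) hf
    (by
      have : ContDiff ℝ ∞ (fun q : P × X => g q.1 (-q.2)) :=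
        hg.comp (contDiff_fst.prodMk contDiff_snd.neg)
      exact this.contDiffOn)
  rw [Set.univ_prod_univ, contDiffOn_univ] at h
  have h2 := h.comp (contDiff_id.prodMk (contDiff_const (c := (0 : X))))
  convert h2 using 1
  ext p
  simp [convolution]

end FourierCompact

section SmoothFamilies

lemma integrable_prod_of_compactSupport {E : Type*} [NormedAddCommGroup E] {K : Set Rd2}
    {H : ℝ → Rd2 → E}
    (hH : Continuous fun p : ℝ × Rd2 => H p.1 p.2) (hK : IsCompact K)
    (h0 : ∀ t, ∀ η ∉ K, H t η = 0) (T : ℝ) :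
    Integrable (Function.uncurry H) ((volume.restrict (Set.Ioc 0 T)).prod volume) := by
  have h1 : IntegrableOn (Function.uncurry H) (Set.Ioc 0 T ×ˢ Set.univ)
      (volume.prod volume) := by
    have h2 : IntegrableOn (Function.uncurry H) (Set.Icc 0 T ×ˢ K) (volume.prod volume) :=
      hH.continuousOn.integrableOn_compact (isCompact_Icc.prod hK)
    refine h2.of_forall_sdiff_eq_zero (measurableSet_Ioc.prod MeasurableSet.univ) ?_
    rintro ⟨t, ξ⟩ ⟨⟨ht, -⟩, hn⟩
    exact h0 t ξ fun h => hn ⟨Set.Ioc_subset_Icc_self ht, h⟩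
  rwa [IntegrableOn, ← Measure.prod_restrict, Measure.restrict_univ] at h1

variable {E : Type*} [NormedAddCommGroup E] [NormedSpace ℂ E]

/-- A jointly smooth one-parameter family of functions supported in a common set `K`. -/
def SmoothFamily (K : Set Rd2) (g : ℝ → Rd2 → E) : Prop :=
  ContDiff ℝ ∞ (fun p : ℝ × Rd2 => g p.1 p.2) ∧ ∀ t, ∀ ξ ∉ K, g t ξ = 0

namespace SmoothFamily

variable {K K' : Set Rd2} {g : ℝ → Rd2 → E}

lemma contDiff (hg : SmoothFamily K g) (t : ℝ) : ContDiff ℝ ∞ (g t) :=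
  hg.1.comp (contDiff_const.prodMk contDiff_id)

lemma hasCompactSupport (hg : SmoothFamily K g) (hK : IsCompact K) (t : ℝ) :
    HasCompactSupport (g t) :=
  HasCompactSupport.intro hK (hg.2 t)

lemma integrable (hg : SmoothFamily K g) (hK : IsCompact K) (t : ℝ) : Integrable (g t) :=
  (hg.contDiff t).continuous.integrable_of_hasCompactSupport (hg.hasCompactSupport hK t)

lemma fourier_fourierInv [CompleteSpace E] (hg : SmoothFamily K g) (hK : IsCompact K) (t : ℝ) :
    𝓕 (𝓕⁻ (g t)) = g t :=
  fourier_fourierInv_of_compactSupport (hg.contDiff t) (hg.hasCompactSupport hK t)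

lemma finset_sum {ι : Type*} (S : Finset ι) {G : ι → ℝ → Rd2 → E}
    (hG : ∀ i ∈ S, SmoothFamily K (G i)) : SmoothFamily K (fun t ξ => ∑ i ∈ S, G i t ξ) :=
  ⟨ContDiff.sum fun i hi => (hG i hi).1,
    fun t ξ hξ => Finset.sum_eq_zero fun i hi => (hG i hi).2 t ξ hξ⟩

lemma smul_of_ne_zero {c : ℝ → Rd2 → ℂ} (hc : SmoothFamily K c) (hK : IsCompact K)
    (h0 : (0 : Rd2) ∉ K) {m : ℝ → Rd2 → E}
    (hm : ∀ p : ℝ × Rd2, p.2 ≠ 0 → ContDiffAt ℝ ∞ (fun p : ℝ × Rd2 => m p.1 p.2) p) :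
    SmoothFamily K (fun t ξ => c t ξ • m t ξ) := by
  refine ⟨contDiff_iff_contDiffAt.2 fun p => ?_, fun t ξ hξ => by simp [hc.2 t ξ hξ]⟩
  by_cases hp : p.2 = 0
  · have hev : (fun q : ℝ × Rd2 => c q.1 q.2 • m q.1 q.2) =ᶠ[nhds p] fun _ => 0 := by
      have : IsOpen {q : ℝ × Rd2 | q.2 ∉ K} := hK.isClosed.isOpen_compl.preimage continuous_snd
      filter_upwards [this.mem_nhds (by simpa [hp] using h0)] with q hq
      simp [hc.2 q.1 q.2 hq]
    exact contDiffAt_const.congr_of_eventuallyEq hev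
  · exact hc.1.contDiffAt.smul (hm p hp)

lemma convolution {a b : ℝ → Rd2 → ℂ} (ha : SmoothFamily K a) (hb : SmoothFamily K' b)
    (hK : IsCompact K) :
    SmoothFamily (K + K') (fun t ξ => ∫ η, a t η * b t (ξ - η)) := by
  constructor
  · have := contDiff_integral_of_compactSupport (P := ℝ × Rd2) (X := Rd2) (F := ℂ) volume
      (f := fun _ => 1) (continuous_const.locallyIntegrable) (k := K) hK
      (g := fun p η => a p.1 η * b p.1 (p.2 - η))
      (fun p x hx => by simp [ha.2 p.1 x hx]) ?_
    · simpa using this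
    · refine ContDiff.mul ?_ ?_
      · exact ha.1.comp (by fun_prop : ContDiff ℝ ∞ fun q : (ℝ × Rd2) × Rd2 => (q.1.1, q.2))
      · exact hb.1.comp
          (by fun_prop : ContDiff ℝ ∞ fun q : (ℝ × Rd2) × Rd2 => (q.1.1, q.1.2 - q.2))
  · intro t ξ hξ
    refine integral_eq_zero_of_ae (Filter.Eventually.of_forall fun η => ?_)
    by_cases h1 : η ∈ K
    · have h2 : ξ - η ∉ K' := fun h2 => hξ ⟨η, h1, ξ - η, h2, by simp⟩
      simp [hb.2 t _ h2]
    · simp [ha.2 t _ h1]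

lemma fourierInv_mul_fourierInv {a b : ℝ → Rd2 → ℂ} (ha : SmoothFamily K a)
    (hb : SmoothFamily K' b) (hK : IsCompact K) (hK' : IsCompact K') (t : ℝ) (x : Rd2) :
    𝓕⁻ (a t) x * 𝓕⁻ (b t) x = 𝓕⁻ (fun ξ => ∫ η, a t η * b t (ξ - η)) x := by
  have := Real.fourier_mul_convolution_eq (ha.integrable hK t) (hb.integrable hK' t) (-x)
  rw [← Real.fourierInv_eq_fourier_neg, ← Real.fourierInv_eq_fourier_neg,
    ← Real.fourierInv_eq_fourier_neg] at this
  rw [← this]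
  rfl

lemma timeIntegral [CompleteSpace E] (hg : SmoothFamily K g) (T : ℝ) :
    SmoothFamily K (fun (_ : ℝ) ξ => ∫ t in (0:ℝ)..T, g t ξ) := by
  obtain ⟨χ, hχ⟩ : ∃ χ : ContDiffBump (0:ℝ), χ.rIn = |T| + 1 :=
    ⟨⟨|T| + 1, |T| + 2, by positivity, by linarith⟩, rfl⟩
  have key : ∀ ξ, ∫ t in (0:ℝ)..T, g t ξ = ∫ t in (0:ℝ)..T, χ t • g t ξ := by
    intro ξ
    refine intervalIntegral.integral_congr fun t ht => ?_
    have : χ t = 1 := by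
      apply χ.one_of_mem_closedBall
      rw [hχ, mem_closedBall_zero_iff, Real.norm_eq_abs]
      have := Set.abs_sub_left_of_mem_uIcc ht
      simp at this
      linarith
    simp [this]
  refine ⟨?_, fun t ξ hξ => by simp [hg.2 _ ξ hξ]⟩
  have hsm : ∀ a b : ℝ, ContDiff ℝ ∞ (fun ξ => ∫ t in Set.Ioc a b, χ t • g t ξ) := by
    intro a b
    have := contDiff_integral_of_compactSupport (P := Rd2) (X := ℝ) (F := E) volume
      (f := (Set.Ioc a b).indicator fun _ => 1)
      ((locallyIntegrable_const 1).indicator measurableSet_Ioc)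
      (k := tsupport χ) χ.hasCompactSupport
      (g := fun ξ t => χ t • g t ξ)
      (fun p x hx => by simp [image_eq_zero_of_notMem_tsupport hx]) ?_
    · convert this using 2 with ξ
      rw [← integral_indicator measurableSet_Ioc]
      congr 1; ext t
      by_cases ht : t ∈ Set.Ioc a b <;> simp [ht]
    · exact (χ.contDiff.comp contDiff_snd).smul (hg.1.comp (contDiff_snd.prodMk contDiff_fst))
  have h2 : ContDiff ℝ ∞ (fun ξ => ∫ t in (0:ℝ)..T, g t ξ) := by
    have : (fun ξ => ∫ t in (0:ℝ)..T, g t ξ) = fun ξ =>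
        (∫ t in Set.Ioc 0 T, χ t • g t ξ) - ∫ t in Set.Ioc T 0, χ t • g t ξ := by
      ext1 ξ
      rw [key ξ, intervalIntegral]
    rw [this]
    exact (hsm 0 T).sub (hsm T 0)
  exact h2.comp contDiff_snd

lemma timeIntegral_fourierInv (hg : SmoothFamily K g) (hK : IsCompact K) {T : ℝ} (hT : 0 ≤ T)
    (x : Rd2) :
    ∫ t in (0:ℝ)..T, 𝓕⁻ (g t) x = 𝓕⁻ (fun ξ => ∫ t in (0:ℝ)..T, g t ξ) x := by
  simp only [Real.fourierInv_eq', intervalIntegral.integral_of_le hT]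
  rw [integral_integral_swap (integrable_prod_of_compactSupport
    ((by fun_prop : Continuous fun p : ℝ × Rd2 =>
      cexp (((2 * Real.pi * inner ℝ p.2 x : ℝ) : ℂ) * I)).smul hg.1.continuous) hK
    (fun t ξ hξ => by simp [hg.2 t ξ hξ]) T)]
  congr 1; ext ξ
  rw [integral_smul]

end SmoothFamily

end SmoothFamilies

section FlowFourier

lemma mulVecE_apply (M : Matrix (Fin 2) (Fin 2) ℂ) (v : Spinor) (i : Fin 2) :
    mulVecE M v i = ∑ j, M i j * v j := rfl

lemma mulVecE_smul (M : Matrix (Fin 2) (Fin 2) ℂ) (c : ℂ) (v : Spinor) :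
    mulVecE M (c • v) = c • mulVecE M v := by
  ext i
  simp [mulVecE_apply]
  ring

lemma mulVecE_sum_smul {ι : Type*} (M : Matrix (Fin 2) (Fin 2) ℂ) (S : Finset ι) (c : ι → ℂ)
    (v : ι → Spinor) :
    mulVecE M (∑ i ∈ S, c i • v i) = ∑ i ∈ S, c i • mulVecE M (v i) := by
  ext i
  simp only [mulVecE_apply, WithLp.ofLp_sum, WithLp.ofLp_smul, Finset.sum_apply, Pi.smul_apply,
    smul_eq_mul, Finset.mul_sum]
  rw [Finset.sum_comm]
  refine Finset.sum_congr rfl fun k _ => Finset.sum_congr rfl fun j _ => ?_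
  ring

/-- The symbol of the half-wave propagator `U_±(t)`. -/
def halfWaveSym (sg t : ℝ) (ξ : Rd2) : ℂ := cexp (-I * ((sg * t * ‖ξ‖ : ℝ) : ℂ))

/-- The symbol of the map from `a₀` to the datum of `A^{hom}_{μ,±}`. -/
def gaugeSym (sg : ℝ) (μ : Fin 3) (η : Rd2) : ℂ :=
  if μ = 0 then 1/2 else -(sg : ℂ) * (1/2) * ((I * ((η (sIdx μ) : ℝ) : ℂ)) / (I * (‖η‖ : ℂ)))

lemma contDiffAt_halfWaveSym (sg : ℝ) {τ : ℝ × Rd2 → ℝ} {p : ℝ × Rd2} (hτ : ContDiff ℝ ∞ τ)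
    (hp : p.2 ≠ 0) : ContDiffAt ℝ ∞ (fun p : ℝ × Rd2 => halfWaveSym sg (τ p) p.2) p := by
  unfold halfWaveSym
  have h1 : ContDiffAt ℝ ∞ (fun p : ℝ × Rd2 => ‖p.2‖) p := contDiffAt_snd.norm ℝ hp
  have h2 : ContDiffAt ℝ ∞ (fun p : ℝ × Rd2 => ((sg * τ p * ‖p.2‖ : ℝ) : ℂ)) p :=
    ofRealCLM.contDiff.contDiffAt.comp p ((contDiffAt_const.mul hτ.contDiffAt).mul h1)
  exact (contDiffAt_const.mul h2).cexp

lemma contDiffAt_coord (i : Fin 2) (p : ℝ × Rd2) :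
    ContDiffAt ℝ ∞ (fun p : ℝ × Rd2 => ((p.2 i : ℝ) : ℂ)) p := by
  have h0 : ContDiff ℝ ∞ (fun p : ℝ × Rd2 => p.2 i) := by fun_prop
  exact ofRealCLM.contDiff.contDiffAt.comp p h0.contDiffAt

lemma contDiffAt_ofReal_norm {p : ℝ × Rd2} (hp : p.2 ≠ 0) :
    ContDiffAt ℝ ∞ (fun p : ℝ × Rd2 => ((‖p.2‖ : ℝ) : ℂ)) p :=
  ofRealCLM.contDiff.contDiffAt.comp p (contDiffAt_snd.norm ℝ hp)

lemma contDiffAt_rieszSym (i : Fin 2) {p : ℝ × Rd2} (hp : p.2 ≠ 0) :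
    ContDiffAt ℝ ∞ (fun p : ℝ × Rd2 => (I * ((p.2 i : ℝ) : ℂ)) / (I * (‖p.2‖ : ℂ))) p := by
  simp only [div_eq_mul_inv]
  refine ContDiffAt.mul ?_ (ContDiffAt.inv ?_ ?_)
  · exact contDiffAt_const.mul (contDiffAt_coord _ p)
  · exact contDiffAt_const.mul (contDiffAt_ofReal_norm hp)
  · simpa using hp

lemma contDiffAt_gaugeSym (sg : ℝ) (μ : Fin 3) {p : ℝ × Rd2} (hp : p.2 ≠ 0) :
    ContDiffAt ℝ ∞ (fun p : ℝ × Rd2 => gaugeSym sg μ p.2) p := by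
  unfold gaugeSym
  split_ifs
  · exact contDiffAt_const
  · exact contDiffAt_const.mul (contDiffAt_rieszSym _ hp)

lemma contDiffAt_mulVecE_PiSym (sg : ℝ) (w : Spinor) {p : ℝ × Rd2} (hp : p.2 ≠ 0) :
    ContDiffAt ℝ ∞ (fun p : ℝ × Rd2 => mulVecE (PiSym sg p.2) w) p := by
  rw [contDiffAt_piLp]
  intro i
  simp only [mulVecE_apply]
  refine ContDiffAt.sum fun j _ => ContDiffAt.mul ?_ contDiffAt_const
  simp only [PiSym, Matrix.smul_apply, Matrix.add_apply, smul_eq_mul]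
  refine contDiffAt_const.mul (contDiffAt_const.add (ContDiffAt.mul ?_ ?_))
  · have : ContDiffAt ℝ ∞ (fun p : ℝ × Rd2 => sg / ‖p.2‖) p :=
      contDiffAt_const.div (contDiffAt_snd.norm ℝ hp) (by simpa using hp)
    exact ofRealCLM.contDiff.contDiffAt.comp p this
  · exact ((contDiffAt_coord _ p).mul contDiffAt_const).add
      ((contDiffAt_coord _ p).mul contDiffAt_const)

/-- The Fourier transform of `A^{hom}_{μ,±}(t)` when `A` is that of `a₀`. -/
def gaugeHat (A : Rd2 → ℂ) (sg : ℝ) (μ : Fin 3) (t : ℝ) (η : Rd2) : ℂ :=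
  A η • (halfWaveSym sg t η * gaugeSym sg μ η)

/-- The Fourier transform of `U_±(t)φ` when `B` is that of `φ`. -/
def waveHat (B : Rd2 → ℂ) (sg t : ℝ) (ζ : Rd2) : ℂ := B ζ • halfWaveSym sg t ζ

/-- The Fourier transform of the product `A^{hom}_{μ,±}(t) U_±(t)φ`. -/
def productHat (A B : Rd2 → ℂ) (s2 s3 : ℝ) (μ : Fin 3) (t : ℝ) (ξ : Rd2) : ℂ :=
  ∫ η, gaugeHat A s2 μ t η * waveHat B s3 t (ξ - η)

/-- The Fourier transform of the Duhamel integrand in `Gflow`, for the spinor datum `φ • v`. -/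
def duhamelHat (A B : Rd2 → ℂ) (v : Spinor) (s1 s2 s3 t t' : ℝ) (ξ : Rd2) : Spinor :=
  ∑ μ : Fin 3, productHat A B s2 s3 μ t' ξ •
    (halfWaveSym s1 (t - t') ξ • mulVecE (PiSym s1 ξ) (mulVecE (alphaM μ) v))

variable {A B : Rd2 → ℂ} {K K' : Set Rd2}

lemma smoothFamily_gaugeHat (hA : SmoothFamily K fun _ => A) (hK : IsCompact K)
    (h0 : (0 : Rd2) ∉ K) (sg : ℝ) (μ : Fin 3) : SmoothFamily K (gaugeHat A sg μ) :=
  hA.smul_of_ne_zero hK h0 fun _ hp =>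
    (contDiffAt_halfWaveSym sg contDiff_fst hp).mul (contDiffAt_gaugeSym sg μ hp)

lemma smoothFamily_waveHat (hB : SmoothFamily K fun _ => B) (hK : IsCompact K)
    (h0 : (0 : Rd2) ∉ K) (sg : ℝ) : SmoothFamily K (waveHat B sg) :=
  hB.smul_of_ne_zero hK h0 fun _ hp => contDiffAt_halfWaveSym sg contDiff_fst hp

lemma smoothFamily_productHat (hA : SmoothFamily K fun _ => A) (hK : IsCompact K)
    (h0 : (0 : Rd2) ∉ K) (hB : SmoothFamily K' fun _ => B) (hK' : IsCompact K')
    (h0' : (0 : Rd2) ∉ K') (s2 s3 : ℝ) (μ : Fin 3) :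
    SmoothFamily (K + K') (productHat A B s2 s3 μ) :=
  (smoothFamily_gaugeHat hA hK h0 s2 μ).convolution (smoothFamily_waveHat hB hK' h0' s3) hK

lemma smoothFamily_duhamelHat (hA : SmoothFamily K fun _ => A) (hK : IsCompact K)
    (h0 : (0 : Rd2) ∉ K) (hB : SmoothFamily K' fun _ => B) (hK' : IsCompact K')
    (h0' : (0 : Rd2) ∉ K') (hs : (0 : Rd2) ∉ K + K') (v : Spinor) (s1 s2 s3 t : ℝ) :
    SmoothFamily (K + K') (duhamelHat A B v s1 s2 s3 t) :=
  SmoothFamily.finset_sum _ fun μ _ =>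
    (smoothFamily_productHat hA hK h0 hB hK' h0' s2 s3 μ).smul_of_ne_zero (hK.add hK') hs
      fun _ hp => (contDiffAt_halfWaveSym s1 (contDiff_const.sub contDiff_fst) hp).smul
        (contDiffAt_mulVecE_PiSym s1 _ hp)

lemma Ahom_eq {a0 : Rd2 → ℂ} (ha : 𝓕 a0 = A) (hA : SmoothFamily K fun _ => A) (hK : IsCompact K)
    (h0 : (0 : Rd2) ∉ K) (sg : ℝ) (μ : Fin 3) (t : ℝ) (y : Rd2) :
    Ahom sg a0 μ t y = 𝓕⁻ (gaugeHat A sg μ t) y := by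
  by_cases hμ : μ = 0
  · simp only [Ahom, hμ, if_true, Uop, fmul, ha]
    rw [← fourierInv_const_mul]
    refine congrArg (fun f : Rd2 → ℂ => 𝓕⁻ f y) (funext fun η => ?_)
    simp only [gaugeHat, gaugeSym, halfWaveSym, if_true, smul_eq_mul]
    ring
  · have h1 : SmoothFamily K fun (_ : ℝ) η =>
        A η • ((I * ((η (sIdx μ) : ℝ) : ℂ)) / (I * (‖η‖ : ℂ))) := 
      hA.smul_of_ne_zero hK h0 fun p hp => contDiffAt_rieszSym _ hp
    have h2 := h1.fourier_fourierInv hK 0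
    have h3 : (fun η => ((I * ((η (sIdx μ) : ℝ) : ℂ)) / (I * (‖η‖ : ℂ))) • A η) = fun η =>
        A η • ((I * ((η (sIdx μ) : ℝ) : ℂ)) / (I * (‖η‖ : ℂ))) := by
      ext η; simp only [smul_eq_mul]; ring
    simp only [Ahom, hμ, if_false, Uop, fmul, ha]
    rw [h3, h2, ← fourierInv_const_mul]
    refine congrArg (fun f : Rd2 → ℂ => 𝓕⁻ f y) (funext fun η => ?_)
    simp only [gaugeHat, gaugeSym, halfWaveSym, hμ, if_false, smul_eq_mul]
    ring

lemma Uop_smul_eq {φ : Rd2 → ℂ} (hφ : 𝓕 φ = B) (v : Spinor) (sg t : ℝ) (y : Rd2) :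
    Uop sg t (fun x => φ x • v) y = 𝓕⁻ (waveHat B sg t) y • v := by
  simp only [Uop, fmul]
  rw [← fourierInv_smul_vec]
  refine congrArg (fun f : Rd2 → Spinor => 𝓕⁻ f y) (funext fun ζ => ?_)
  rw [fourier_smul_vec, hφ, smul_smul, waveHat, halfWaveSym, smul_eq_mul, mul_comm]

lemma Uop_PiOp_eq {a0 φ : Rd2 → ℂ} (ha : 𝓕 a0 = A) (hφ : 𝓕 φ = B)
    (hA : SmoothFamily K fun _ => A) (hK : IsCompact K)
    (h0 : (0 : Rd2) ∉ K) (hB : SmoothFamily K' fun _ => B) (hK' : IsCompact K')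
    (h0' : (0 : Rd2) ∉ K') (hs : (0 : Rd2) ∉ K + K') (v : Spinor) (s1 s2 s3 t t' : ℝ) (x : Rd2) :
    Uop s1 (t - t') (PiOp s1 (fun y => ∑ μ : Fin 3,
      Ahom s2 a0 μ t' y • mulVecE (alphaM μ) (Uop s3 t' (fun x => φ x • v) y))) x =
      𝓕⁻ (duhamelHat A B v s1 s2 s3 t t') x := by
  have hP := fun μ => smoothFamily_productHat hA hK h0 hB hK' h0' s2 s3 μ
  have e1 : (fun y => ∑ μ : Fin 3,
      Ahom s2 a0 μ t' y • mulVecE (alphaM μ) (Uop s3 t' (fun x => φ x • v) y)) =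
      fun y => ∑ μ : Fin 3, 𝓕⁻ (productHat A B s2 s3 μ t') y • mulVecE (alphaM μ) v := by
    ext1 y
    refine Finset.sum_congr rfl fun μ _ => ?_
    rw [Ahom_eq ha hA hK h0, Uop_smul_eq hφ, mulVecE_smul, smul_smul,
      (smoothFamily_gaugeHat hA hK h0 s2 μ).fourierInv_mul_fourierInv
        (smoothFamily_waveHat hB hK' h0' s3) hK hK']
    rfl
  have e2 : 𝓕 (fun y => ∑ μ : Fin 3, 𝓕⁻ (productHat A B s2 s3 μ t') y • mulVecE (alphaM μ) v) =
      fun ξ => ∑ μ : Fin 3, productHat A B s2 s3 μ t' ξ • mulVecE (alphaM μ) v := by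
    ext1 ξ
    rw [fourier_finset_sum]
    · refine Finset.sum_congr rfl fun μ _ => ?_
      rw [fourier_smul_vec, (hP μ).fourier_fourierInv (hK.add hK')]
    · intro μ _
      exact (integrable_fourierInv_of_compactSupport ((hP μ).contDiff t')
        ((hP μ).hasCompactSupport (hK.add hK') t')).smul_const _
  have h3 : SmoothFamily (K + K') fun t' ξ => ∑ μ : Fin 3, productHat A B s2 s3 μ t' ξ •
      mulVecE (PiSym s1 ξ) (mulVecE (alphaM μ) v) :=
    SmoothFamily.finset_sum _ fun μ _ => (hP μ).smul_of_ne_zero (hK.add hK') hs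
      fun _ hp => contDiffAt_mulVecE_PiSym s1 _ hp
  simp only [Uop, fmul, PiOp]
  simp only [Uop, fmul] at e1
  rw [e1, e2]
  simp only [mulVecE_sum_smul]
  rw [h3.fourier_fourierInv (hK.add hK')]
  refine congrArg (fun f : Rd2 → Spinor => 𝓕⁻ f x) (funext fun ξ => ?_)
  rw [duhamelHat, Finset.smul_sum]
  exact Finset.sum_congr rfl fun μ _ => smul_comm _ _ _

lemma fourier_Gflow {a0 φ : Rd2 → ℂ} (ha : 𝓕 a0 = A) (hφ : 𝓕 φ = B)
    (hA : SmoothFamily K fun _ => A) (hK : IsCompact K)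
    (h0 : (0 : Rd2) ∉ K) (hB : SmoothFamily K' fun _ => B) (hK' : IsCompact K')
    (h0' : (0 : Rd2) ∉ K') (hs : (0 : Rd2) ∉ K + K') (v : Spinor) {t : ℝ} (ht : 0 ≤ t) :
    𝓕 (Gflow a0 (fun x => φ x • v) t) = fun ξ => ∑ s1 : Bool, ∑ s2 : Bool, ∑ s3 : Bool,
      ∫ t' in (0:ℝ)..t, duhamelHat A B v (sv s1) (sv s2) (sv s3) t t' ξ := by
  have hD := fun s1 s2 s3 => smoothFamily_duhamelHat hA hK h0 hB hK' h0' hs v s1 s2 s3 t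
  have hI := fun s1 s2 s3 => (hD s1 s2 s3).timeIntegral t
  have hc := hK.add hK'
  have hInt : ∀ s1 s2 s3 : ℝ, Integrable
      (𝓕⁻ (fun ξ => ∫ t' in (0:ℝ)..t, duhamelHat A B v s1 s2 s3 t t' ξ)) := fun s1 s2 s3 =>
    integrable_fourierInv_of_compactSupport ((hI s1 s2 s3).contDiff 0)
      ((hI s1 s2 s3).hasCompactSupport hc 0)
  have e : Gflow a0 (fun x => φ x • v) t = fun x => ∑ s1 : Bool, ∑ s2 : Bool, ∑ s3 : Bool,
      𝓕⁻ (fun ξ => ∫ t' in (0:ℝ)..t, duhamelHat A B v (sv s1) (sv s2) (sv s3) t t' ξ) x := by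
    ext1 x
    simp only [Gflow, Uop_PiOp_eq ha hφ hA hK h0 hB hK' h0' hs,
      (hD _ _ _).timeIntegral_fourierInv hc ht]
  rw [e]
  ext1 ξ
  rw [fourier_finset_sum]
  swap
  · exact fun s1 _ => integrable_finsetSum _ fun s2 _ => integrable_finsetSum _ fun s3 _ =>
      hInt _ _ _
  refine Finset.sum_congr rfl fun s1 _ => ?_
  rw [fourier_finset_sum]
  swap
  · exact fun s2 _ => integrable_finsetSum _ fun s3 _ => hInt _ _ _
  refine Finset.sum_congr rfl fun s2 _ => ?_
  rw [fourier_finset_sum]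
  swap
  · exact fun s3 _ => hInt _ _ _
  refine Finset.sum_congr rfl fun s3 _ => ?_
  rw [(hI _ _ _).fourier_fourierInv hc 0]

end FlowFourier

section Oscillatory

/-- The oscillatory time integral with phase `Φ`. -/
def timeOsc (t Φ : ℝ) : ℂ := ∫ t' in (0:ℝ)..t, cexp (I * ((t' * Φ : ℝ) : ℂ))

lemma norm_timeOsc_le {t : ℝ} (ht : 0 ≤ t) (Φ : ℝ) : ‖timeOsc t Φ‖ ≤ t := by
  have := intervalIntegral.norm_integral_le_of_norm_le_const (a := 0) (b := t) (C := 1)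
    (f := fun t' : ℝ => cexp (I * ((t' * Φ : ℝ) : ℂ)))
    (fun x _ => by rw [mul_comm, norm_exp_ofReal_mul_I])
  simpa [timeOsc, abs_of_nonneg ht] using this

lemma norm_timeOsc_le_inv (t : ℝ) {Φ m : ℝ} (hm : 0 < m) (h : m ≤ Φ) :
    ‖timeOsc t Φ‖ ≤ 2 / m := by
  have hΦ : 0 < Φ := hm.trans_le h
  have hne : I * (Φ : ℂ) ≠ 0 := mul_ne_zero I_ne_zero (by exact_mod_cast hΦ.ne')
  have e : timeOsc t Φ = (cexp (((t * Φ : ℝ) : ℂ) * I) - 1) / (I * Φ) := by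
    have := integral_exp_mul_complex (a := 0) (b := t) hne
    simp only [ofReal_zero, mul_zero, Complex.exp_zero] at this
    rw [timeOsc]
    convert this using 3
    · push_cast; ring_nf
    · push_cast; ring_nf
  rw [e, norm_div, norm_mul, norm_I, one_mul, norm_real, Real.norm_of_nonneg hΦ.le]
  have h1 : ‖cexp (((t * Φ : ℝ) : ℂ) * I) - 1‖ ≤ 2 := by
    refine (norm_sub_le _ _).trans ?_
    rw [norm_exp_ofReal_mul_I]
    norm_num
  gcongr

lemma half_le_re_timeOsc {t Φ : ℝ} (ht : 0 ≤ t) (ht1 : t ≤ 1) (h : |Φ| ≤ 1) :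
    t / 2 ≤ (timeOsc t Φ).re := by
  have hc : Continuous fun t' : ℝ => cexp (I * ((t' * Φ : ℝ) : ℂ)) := by fun_prop
  have e : (timeOsc t Φ).re = ∫ t' in (0:ℝ)..t, Real.cos (t' * Φ) := by
    have := reCLM.intervalIntegral_comp_comm (μ := volume) (a := 0) (b := t)
      (hc.intervalIntegrable 0 t)
    rw [timeOsc, ← reCLM_apply, ← this]
    refine intervalIntegral.integral_congr fun x _ => ?_
    simp only [reCLM_apply]
    rw [mul_comm, exp_ofReal_mul_I_re]
  rw [e]
  have h2 : ∫ _ in (0:ℝ)..t, (1/2 : ℝ) ≤ ∫ t' in (0:ℝ)..t, Real.cos (t' * Φ) := by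
    refine intervalIntegral.integral_mono_on ht (by simp)
      ((by fun_prop : Continuous fun t' : ℝ => Real.cos (t' * Φ)).intervalIntegrable _ _) ?_
    intro x hx
    have h3 := Real.one_sub_sq_div_two_le_cos (x := x * Φ)
    have h4 : |x * Φ| ≤ 1 := by
      rw [abs_mul, abs_of_nonneg hx.1]
      exact mul_le_one₀ (hx.2.trans ht1) (abs_nonneg _) h
    have h5 : (x * Φ) ^ 2 ≤ 1 := by
      rw [← sq_abs]; exact pow_le_one₀ (abs_nonneg _) h4
    linarith
  simp at h2
  linarith

lemma norm_sq_eq (ξ : Rd2) : ‖ξ‖ ^ 2 = ξ 0 ^ 2 + ξ 1 ^ 2 := by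
  rw [EuclideanSpace.real_norm_sq_eq, Fin.sum_univ_two]

/-- The direction of `ξ` as a unit complex number. -/
def direction (ξ : Rd2) : ℂ := ((ξ 0 : ℝ) + (ξ 1 : ℝ) * I) / (‖ξ‖ : ℂ)

lemma conj_direction_mul_self {ξ : Rd2} (hξ : ξ ≠ 0) :
    (starRingEnd ℂ) (direction ξ) * direction ξ = 1 := by
  have h : ((‖ξ‖ : ℝ) : ℂ) ≠ 0 := by simpa using hξ
  have h2 : ((‖ξ‖ : ℝ) : ℂ) ^ 2 = (ξ 0 : ℂ) ^ 2 + (ξ 1 : ℂ) ^ 2 := by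
    exact_mod_cast norm_sq_eq ξ
  simp only [direction, map_div₀, map_add, map_mul, conj_ofReal, conj_I]
  field_simp
  rw [h2]
  linear_combination -(ξ 1 : ℂ) ^ 2 * I_sq

lemma norm_direction_le (ξ : Rd2) : ‖direction ξ‖ ≤ 1 := by
  by_cases h : ξ = 0
  · simp [direction, h]
  · have := congrArg norm (conj_direction_mul_self h)
    rw [norm_mul, RCLike.norm_conj, norm_one] at this
    nlinarith [norm_nonneg (direction ξ)]

/-- The time-integrated symbol of the bilinear operator `Gflow`, projected to the positive
eigenspinor at the output frequency `ξ`. -/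
def bilinearSym (t : ℝ) (ξ η : Rd2) : ℂ :=
  ∑ s2 : Bool, ∑ s3 : Bool,
    (1/2 : ℂ) * (1 - sv s2 * ((starRingEnd ℂ) (direction ξ) * direction η)) *
      timeOsc t (‖ξ‖ - sv s2 * ‖η‖ - sv s3 * ‖ξ - η‖)

set_option maxHeartbeats 1000000 in
lemma bilinearSym_lower {t r : ℝ} (ht : 0 < t) (ht1 : t ≤ 1) (hr : 5 ≤ r) (hrt : 384 ≤ r * t)
    {ξ η ζ : Rd2} (hξ : ξ = η + ζ)
    (hη0 : η 0 ∈ Set.Icc (r ^ 2) (3 / 2 * r ^ 2)) (hη1 : η 1 ∈ Set.Icc (r / 2) r)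
    (hζ0 : ζ 0 ∈ Set.Icc (3 * r ^ 2) (7 / 2 * r ^ 2)) (hζ1 : ζ 1 ∈ Set.Icc (-r) (-(r / 2))) :
    t / (128 * r) ≤ -(bilinearSym t ξ η).im := by
  obtain ⟨hη0l, hη0u⟩ := hη0
  obtain ⟨hη1l, hη1u⟩ := hη1
  obtain ⟨hζ0l, hζ0u⟩ := hζ0
  obtain ⟨hζ1l, hζ1u⟩ := hζ1
  have hr0 : 0 < r := by linarith
  have hr2 : 25 ≤ r ^ 2 := by nlinarith
  have hξ0 : ξ 0 = η 0 + ζ 0 := by simp [hξ]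
  have hξ1 : ξ 1 = η 1 + ζ 1 := by simp [hξ]
  have hζ : ξ - η = ζ := by simp [hξ]
  have ha2 := norm_sq_eq η
  have hb2 := norm_sq_eq ζ
  have hc2 := norm_sq_eq ξ
  have htri : ‖ξ‖ ≤ ‖η‖ + ‖ζ‖ := hξ ▸ norm_add_le η ζ
  have ha0 := norm_nonneg η
  have hb0 := norm_nonneg ζ
  have hc0 := norm_nonneg ξ
  have hal : r ^ 2 ≤ ‖η‖ := hη0l.trans (abs_le_of_sq_le_sq' (by nlinarith) ha0).2
  have hau : ‖η‖ ≤ η 0 + 1 / 2 := (abs_le_of_sq_le_sq' (by nlinarith) (by linarith)).2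
  have hbl : 3 * r ^ 2 ≤ ‖ζ‖ := hζ0l.trans (abs_le_of_sq_le_sq' (by nlinarith) hb0).2
  have hbu : ‖ζ‖ ≤ ζ 0 + 1 / 2 := (abs_le_of_sq_le_sq' (by nlinarith) (by linarith)).2
  have hcl' : ξ 0 ≤ ‖ξ‖ := (abs_le_of_sq_le_sq' (by nlinarith) hc0).2
  have hcl : 4 * r ^ 2 ≤ ‖ξ‖ := by linarith
  have hca : 0 < ‖ξ‖ * ‖η‖ := mul_pos (by linarith) (by linarith)
  set C : ℝ := (ξ 0 * η 0 + ξ 1 * η 1) / (‖ξ‖ * ‖η‖) with hC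
  set S : ℝ := (ξ 0 * η 1 - ξ 1 * η 0) / (‖ξ‖ * ‖η‖) with hS
  have hz : (starRingEnd ℂ) (direction ξ) * direction η = C + S * I := by
    have h1 : ((‖ξ‖ : ℝ) : ℂ) ≠ 0 := by exact_mod_cast (by linarith : ‖ξ‖ ≠ 0)
    have h2 : ((‖η‖ : ℝ) : ℂ) ≠ 0 := by exact_mod_cast (by linarith : ‖η‖ ≠ 0)
    simp only [direction, map_div₀, map_add, map_mul, conj_ofReal, conj_I, hC, hS]
    push_cast
    field_simp
    linear_combination -(ξ 1 : ℂ) * (η 1 : ℂ) * I_sq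
  have hCS : C ^ 2 + S ^ 2 = 1 := by
    rw [hC, hS, div_pow, div_pow, ← add_div, div_eq_one_iff_eq (by positivity), mul_pow, hc2, ha2]
    ring
  have hC0 : 0 ≤ C := by
    refine div_nonneg ?_ hca.le
    nlinarith
  have hSl : 1 / (8 * r) ≤ S := by
    have h1 : 2 * r ^ 3 ≤ ξ 0 * η 1 - ξ 1 * η 0 := by
      rw [hξ0, hξ1]
      have h2 : (3 * r ^ 2) * (r / 2) ≤ ζ 0 * η 1 := by
        apply mul_le_mul <;> linarith
      have h3 : (r / 2) * r ^ 2 ≤ (-ζ 1) * η 0 := by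
        apply mul_le_mul <;> linarith
      linarith
    have h2 : ‖ξ‖ * ‖η‖ ≤ 16 * r ^ 4 := by
      have : ‖ξ‖ * ‖η‖ ≤ (8 * r ^ 2) * (2 * r ^ 2) := by
        apply mul_le_mul <;> linarith
      linarith
    rw [hS, div_le_div_iff₀ (by positivity) hca]
    calc 1 * (‖ξ‖ * ‖η‖) ≤ 2 * r ^ 3 * (8 * r) := by linarith
      _ ≤ _ := by gcongr
  have hSu : S ≤ 1 / 4 := by
    have h1 : ξ 0 * η 1 - ξ 1 * η 0 ≤ 5 * r ^ 3 := by
      rw [hξ0, hξ1]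
      have h2 : ζ 0 * η 1 ≤ (7 / 2 * r ^ 2) * r := by
        apply mul_le_mul <;> linarith
      have h3 : (-ζ 1) * η 0 ≤ r * (3 / 2 * r ^ 2) := by
        apply mul_le_mul <;> linarith
      linarith
    have h2 : 4 * r ^ 4 ≤ ‖ξ‖ * ‖η‖ := by
      have : (4 * r ^ 2) * r ^ 2 ≤ ‖ξ‖ * ‖η‖ := by
        apply mul_le_mul <;> linarith
      linarith
    rw [hS, div_le_iff₀ hca]
    have h3 : 5 * r ^ 3 ≤ r * r ^ 3 := by gcongr
    linarith
  have hS0 : 0 ≤ S := le_trans (by positivity) hSl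
  have hC2 : 0 ≤ 1 - C :=
    sub_nonneg.2 (abs_le_of_sq_le_sq' (by linarith [sq_nonneg S]) zero_le_one).2
  have hC1 : 1 - C ≤ S ^ 2 := by
    have := mul_nonneg hC0 hC2
    have : C * (1 - C) = C - C ^ 2 := by ring
    linarith
  have hznorm : ‖(C : ℂ) + S * I‖ ≤ 1 := by
    rw [← hz, norm_mul, RCLike.norm_conj]
    exact mul_le_one₀ (norm_direction_le _) (norm_nonneg _) (norm_direction_le _)
  have hm : ‖(1/2 : ℂ) * (1 - (C + S * I))‖ ≤ 1 := by
    rw [norm_mul]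
    have := norm_sub_le (1:ℂ) (C + S * I)
    norm_num at this ⊢
    linarith
  have hp : ‖(1/2 : ℂ) * (1 + (C + S * I))‖ ≤ 1 := by
    rw [norm_mul]
    have := norm_add_le (1:ℂ) (C + S * I)
    norm_num at this ⊢
    linarith
  have hr2pos : 0 < r ^ 2 := by positivity
  have b1 : ‖(1/2 : ℂ) * (1 - (C + S * I)) * timeOsc t (‖ξ‖ - ‖η‖ + ‖ζ‖)‖ ≤ 2 / (4 * r ^ 2) := by
    rw [norm_mul]
    have := norm_timeOsc_le_inv t (m := 4 * r ^ 2) (by positivity)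
      (by linarith : 4 * r ^ 2 ≤ ‖ξ‖ - ‖η‖ + ‖ζ‖)
    exact (mul_le_mul hm this (norm_nonneg _) zero_le_one).trans_eq (one_mul _)
  have b2 : ‖(1/2 : ℂ) * (1 + (C + S * I)) * timeOsc t (‖ξ‖ + ‖η‖ - ‖ζ‖)‖ ≤ 2 / (r ^ 2) := by
    rw [norm_mul]
    have := norm_timeOsc_le_inv t (m := r ^ 2) (by positivity)
      (by linarith : r ^ 2 ≤ ‖ξ‖ + ‖η‖ - ‖ζ‖)
    exact (mul_le_mul hp this (norm_nonneg _) zero_le_one).trans_eq (one_mul _)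
  have b3 : ‖(1/2 : ℂ) * (1 + (C + S * I)) * timeOsc t (‖ξ‖ + ‖η‖ + ‖ζ‖)‖ ≤ 2 / (4 * r ^ 2) := by
    rw [norm_mul]
    have := norm_timeOsc_le_inv t (m := 4 * r ^ 2) (by positivity)
      (by linarith : 4 * r ^ 2 ≤ ‖ξ‖ + ‖η‖ + ‖ζ‖)
    exact (mul_le_mul hp this (norm_nonneg _) zero_le_one).trans_eq (one_mul _)
  have hphase : |‖ξ‖ - ‖η‖ - ‖ζ‖| ≤ 1 := by
    rw [abs_le]; constructor <;> linarith
  have hRe := half_le_re_timeOsc ht.le ht1 hphase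
  have hIm : |(timeOsc t (‖ξ‖ - ‖η‖ - ‖ζ‖)).im| ≤ t :=
    (abs_im_le_norm _).trans (norm_timeOsc_le ht.le _)
  have hmain : ((1/2 : ℂ) * (1 - (C + S * I)) * timeOsc t (‖ξ‖ - ‖η‖ - ‖ζ‖)).im
      = -(1 / 2 * (S * (timeOsc t (‖ξ‖ - ‖η‖ - ‖ζ‖)).re
        - (1 - C) * (timeOsc t (‖ξ‖ - ‖η‖ - ‖ζ‖)).im)) := by
    simp [mul_im]
    ring
  have hsum : bilinearSym t ξ η =
      (1/2 : ℂ) * (1 - (C + S * I)) * timeOsc t (‖ξ‖ - ‖η‖ - ‖ζ‖) +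
      (1/2 : ℂ) * (1 - (C + S * I)) * timeOsc t (‖ξ‖ - ‖η‖ + ‖ζ‖) +
      (1/2 : ℂ) * (1 + (C + S * I)) * timeOsc t (‖ξ‖ + ‖η‖ - ‖ζ‖) +
      (1/2 : ℂ) * (1 + (C + S * I)) * timeOsc t (‖ξ‖ + ‖η‖ + ‖ζ‖) := by
    simp only [bilinearSym, Fintype.sum_bool, hz, hζ, sv]
    simp
    ring
  rw [hsum, add_im, add_im, add_im, hmain]
  have i1 := (le_abs_self _).trans ((abs_im_le_norm _).trans b1)
  have i2 := (le_abs_self _).trans ((abs_im_le_norm _).trans b2)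
  have i3 := (le_abs_self _).trans ((abs_im_le_norm _).trans b3)
  have e1 : t / (64 * r) ≤ 1 / 2 * (S * (timeOsc t (‖ξ‖ - ‖η‖ - ‖ζ‖)).re
        - (1 - C) * (timeOsc t (‖ξ‖ - ‖η‖ - ‖ζ‖)).im) := by
    have j1 : S * (t / 2) ≤ S * (timeOsc t (‖ξ‖ - ‖η‖ - ‖ζ‖)).re :=
      mul_le_mul_of_nonneg_left hRe hS0
    have j2 : (1 - C) * (timeOsc t (‖ξ‖ - ‖η‖ - ‖ζ‖)).im ≤ S ^ 2 * t := by
      have := (abs_le.1 hIm).2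
      calc _ ≤ (1 - C) * t := mul_le_mul_of_nonneg_left this hC2
        _ ≤ _ := mul_le_mul_of_nonneg_right hC1 ht.le
    have j3 : S ^ 2 * t ≤ 1 / 4 * (S * t) := by
      rw [sq, mul_assoc]
      exact mul_le_mul_of_nonneg_right hSu (mul_nonneg hS0 ht.le)
    have j4 : t / (64 * r) = 1 / 8 * (1 / (8 * r) * t) := by field_simp; norm_num
    rw [j4]
    linarith [mul_le_mul_of_nonneg_right hSl ht.le]
  have e2 : t / (64 * r) - 3 / r ^ 2 ≥ t / (128 * r) := by
    have : 3 / r ^ 2 ≤ t / (128 * r) := by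
      rw [div_le_div_iff₀ hr2pos (by positivity)]
      have := mul_le_mul_of_nonneg_right hrt hr0.le
      calc 3 * (128 * r) = 384 * r := by ring
        _ ≤ r * t * r := this
        _ = t * r ^ 2 := by ring
    have h2 : t / (64 * r) = t / (128 * r) + t / (128 * r) := by field_simp; norm_num
    linarith
  have e3 : 2 / (4 * r ^ 2) = 1 / 2 * (1 / r ^ 2) := by field_simp; norm_num
  have e4 : 2 / r ^ 2 = 2 * (1 / r ^ 2) := by field_simp
  have e5 : 3 / r ^ 2 = 3 * (1 / r ^ 2) := by field_simp
  rw [e3] at i1 i3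
  rw [e4] at i2
  rw [e5] at e2
  linarith

end Oscillatory

section Projection

/-- Pairing with the left eigenvector `(1, e^{-iθ})` of `ξ_j α^j / |ξ|`. -/
def ell (ξ : Rd2) : Spinor →L[ℂ] ℂ :=
  EuclideanSpace.proj 0 + (starRingEnd ℂ) (direction ξ) • EuclideanSpace.proj 1

lemma ell_apply (ξ : Rd2) (w : Spinor) :
    ell ξ w = w 0 + (starRingEnd ℂ) (direction ξ) * w 1 := rfl

lemma norm_ell_le (ξ : Rd2) (w : Spinor) : ‖ell ξ w‖ ≤ 2 * ‖w‖ := by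
  rw [ell_apply]
  refine (norm_add_le _ _).trans ?_
  rw [norm_mul, RCLike.norm_conj]
  have h0 := PiLp.norm_apply_le w 0
  have h1 := PiLp.norm_apply_le w 1
  have := mul_le_mul (norm_direction_le ξ) h1 (norm_nonneg _) zero_le_one
  linarith

lemma ell_PiSym (sg : ℝ) {ξ : Rd2} (hξ : ξ ≠ 0) (w : Spinor) :
    ell ξ (mulVecE (PiSym sg ξ) w) = (1 + sg) / 2 * ell ξ w := by
  have h : ((‖ξ‖ : ℝ) : ℂ) ≠ 0 := by simpa using hξ
  have hd := conj_direction_mul_self hξ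
  have e1 : ((sg / ‖ξ‖ : ℝ) : ℂ) * ((ξ 0 : ℝ) + (ξ 1 : ℝ) * I) = sg * direction ξ := by
    rw [direction]; push_cast; field_simp
  have e2 : ((sg / ‖ξ‖ : ℝ) : ℂ) * ((ξ 0 : ℝ) - (ξ 1 : ℝ) * I)
      = sg * (starRingEnd ℂ) (direction ξ) := by
    simp only [direction, map_div₀, map_add, map_mul, conj_ofReal, conj_I]
    push_cast; field_simp; ring
  simp only [ell_apply, mulVecE_apply, PiSym, Matrix.smul_apply, Matrix.add_apply, smul_eq_mul,
    Fin.sum_univ_two, sigma1, sigma2, Matrix.one_apply, Matrix.of_apply, Matrix.cons_val',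
    Matrix.cons_val_zero, Matrix.cons_val_one, Matrix.cons_val_fin_one]
  simp only [if_true, Fin.isValue, zero_ne_one, one_ne_zero, if_false]
  linear_combination (1/2 : ℂ) * w 1 * e2 + (1/2 : ℂ) * (starRingEnd ℂ) (direction ξ) * w 0 * e1
    + (1/2 : ℂ) * sg * w 0 * hd

/-- The first standard basis spinor. -/
def spinorE : Spinor := EuclideanSpace.single 0 1

lemma sum_gaugeSym_mul_ell (sg : ℝ) (ξ η : Rd2) :
    ∑ μ : Fin 3, gaugeSym sg μ η * ell ξ (mulVecE (alphaM μ) spinorE) =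
      (1/2 : ℂ) * (1 - sg * ((starRingEnd ℂ) (direction ξ) * direction η)) := by
  have hI : ∀ x y : ℂ, I * x / (I * y) = x / y := fun x y => mul_div_mul_left _ _ I_ne_zero
  have e : direction η = (η 0 : ℂ) / ‖η‖ + (η 1 : ℂ) / ‖η‖ * I := by rw [direction]; ring
  rw [e]
  simp [Fin.sum_univ_three, gaugeSym, ell_apply, mulVecE_apply, spinorE, alphaM, sigma1, sigma2,
    sIdx, hI]
  ring

end Projection

section ProjectedFlow

variable {A B : Rd2 → ℂ} {K K' : Set Rd2}

lemma contDiffAt_direction {p : ℝ × Rd2} (hp : p.2 ≠ 0) :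
    ContDiffAt ℝ ∞ (fun p : ℝ × Rd2 => direction p.2) p := by
  have h0 := contDiffAt_coord 0 p
  have h1 := contDiffAt_coord 1 p
  have hn := (contDiffAt_ofReal_norm hp).inv (by simpa using hp)
  have hI : ContDiffAt ℝ ∞ (fun _ : ℝ × Rd2 => I) p := contDiffAt_const
  simp only [direction, div_eq_mul_inv]
  exact (h0.add (h1.mul hI)).mul hn

lemma ell_duhamelHat_neg (s2 s3 t t' : ℝ) {ξ : Rd2} (hξ : ξ ≠ 0) :
    ell ξ (duhamelHat A B spinorE (-1) s2 s3 t t' ξ) = 0 := by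
  simp [duhamelHat, map_sum, ell_PiSym _ hξ]

lemma exp_mul_ell_duhamelHat_pos (hA : SmoothFamily K fun _ => A) (hK : IsCompact K)
    (h0 : (0 : Rd2) ∉ K) (hB : SmoothFamily K' fun _ => B) (hK' : IsCompact K')
    (h0' : (0 : Rd2) ∉ K') (s2 s3 t t' : ℝ) {ξ : Rd2} (hξ : ξ ≠ 0) :
    cexp (I * ((t * ‖ξ‖ : ℝ) : ℂ)) * ell ξ (duhamelHat A B spinorE 1 s2 s3 t t' ξ) =
      ∫ η, A η * B (ξ - η) *
        ((1/2 : ℂ) * (1 - s2 * ((starRingEnd ℂ) (direction ξ) * direction η)) *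
          cexp (I * ((t' * (‖ξ‖ - s2 * ‖η‖ - s3 * ‖ξ - η‖) : ℝ) : ℂ))) := by
  have hInt : ∀ μ, Integrable fun η => gaugeHat A s2 μ t' η * waveHat B s3 t' (ξ - η) := by
    intro μ
    have hg := smoothFamily_gaugeHat hA hK h0 s2 μ
    have hw := smoothFamily_waveHat hB hK' h0' s3
    refine Continuous.integrable_of_hasCompactSupport ?_ ?_
    · exact (hg.contDiff t').continuous.mul
        ((hw.contDiff t').continuous.comp (continuous_const.sub continuous_id))
    · exact (hg.hasCompactSupport hK t').mul_right
  simp only [duhamelHat, map_sum, map_smul, ell_PiSym _ hξ, smul_eq_mul, productHat]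
  rw [Finset.mul_sum]
  simp only [← integral_mul_const, ← integral_const_mul]
  rw [← integral_finsetSum _ fun μ _ => ((hInt μ).mul_const _).const_mul _]
  refine integral_congr_ae (Filter.Eventually.of_forall fun η => ?_)
  have hexp : cexp (I * ((t' * (‖ξ‖ - s2 * ‖η‖ - s3 * ‖ξ - η‖) : ℝ) : ℂ)) =
      cexp (I * ((t * ‖ξ‖ : ℝ) : ℂ)) * halfWaveSym 1 (t - t') ξ * halfWaveSym s2 t' η *
        halfWaveSym s3 t' (ξ - η) := by
    simp only [halfWaveSym, ← Complex.exp_add]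
    congr 1
    push_cast
    ring
  simp only [← sum_gaugeSym_mul_ell, hexp, gaugeHat, waveHat, smul_eq_mul, Finset.mul_sum,
    Finset.sum_mul]
  refine Finset.sum_congr rfl fun μ _ => ?_
  push_cast
  ring

/-- The Fourier transform of the flow derivative, projected to the positive eigenspinor, is a
bilinear Fourier integral with symbol `bilinearSym`. -/
lemma exp_mul_ell_fourier_Gflow {a0 φ : Rd2 → ℂ} (ha : 𝓕 a0 = A) (hφ : 𝓕 φ = B)
    (hA : SmoothFamily K fun _ => A) (hK : IsCompact K)
    (h0 : (0 : Rd2) ∉ K) (hB : SmoothFamily K' fun _ => B) (hK' : IsCompact K')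
    (h0' : (0 : Rd2) ∉ K') (hs : (0 : Rd2) ∉ K + K') {t : ℝ} (ht : 0 ≤ t) {ξ : Rd2}
    (hξ : ξ ≠ 0) :
    (Integrable fun η => A η * B (ξ - η) * bilinearSym t ξ η) ∧
    cexp (I * ((t * ‖ξ‖ : ℝ) : ℂ)) * ell ξ (𝓕 (Gflow a0 (fun x => φ x • spinorE) t) ξ) =
      ∫ η, A η * B (ξ - η) * bilinearSym t ξ η := by
  set H : ℝ → ℝ → ℝ → Rd2 → ℂ := fun s2 s3 t' η => A η * B (ξ - η) *
        ((1/2 : ℂ) * (1 - s2 * ((starRingEnd ℂ) (direction ξ) * direction η)) *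
          cexp (I * ((t' * (‖ξ‖ - s2 * ‖η‖ - s3 * ‖ξ - η‖) : ℝ) : ℂ))) with hH
  have hHc : ∀ s2 s3, Continuous fun p : ℝ × Rd2 => H s2 s3 p.1 p.2 := by
    intro s2 s3
    have hdir : Continuous fun η => A η * direction η := by
      have := (hA.smul_of_ne_zero hK h0 (m := fun _ η => direction η)
        fun p hp => contDiffAt_direction hp).contDiff 0
      exact this.continuous
    have hAc : Continuous A := (hA.contDiff 0).continuous
    have hBc : Continuous B := (hB.contDiff 0).continuous
    have e : (fun p : ℝ × Rd2 => H s2 s3 p.1 p.2) = fun p : ℝ × Rd2 =>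
        ((1/2 : ℂ) * (A p.2 - s2 * ((starRingEnd ℂ) (direction ξ) * (A p.2 * direction p.2)))) *
        B (ξ - p.2) * cexp (I * ((p.1 * (‖ξ‖ - s2 * ‖p.2‖ - s3 * ‖ξ - p.2‖) : ℝ) : ℂ)) := by
      funext p
      simp only [hH]
      ring
    rw [e]
    have hdir' : Continuous fun p : ℝ × Rd2 => A p.2 * direction p.2 := hdir.comp continuous_snd
    have hpoly : Continuous fun p : ℝ × Rd2 =>
        (1/2 : ℂ) * (A p.2 - s2 * ((starRingEnd ℂ) (direction ξ) * (A p.2 * direction p.2))) :=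
      continuous_const.mul ((hAc.comp continuous_snd).sub
        (continuous_const.mul (continuous_const.mul hdir')))
    refine (hpoly.mul (hBc.comp (by fun_prop))).mul ?_
    fun_prop
  have hH0 : ∀ s2 s3 t', ∀ η ∉ K, H s2 s3 t' η = 0 := by
    intro s2 s3 t' η hη
    simp [hH, hA.2 0 η hη]
  have hprod := fun s2 s3 => integrable_prod_of_compactSupport (hHc s2 s3) hK (hH0 s2 s3) t
  have hosc : ∀ η, A η * B (ξ - η) * bilinearSym t ξ η =
      ∑ s2 : Bool, ∑ s3 : Bool, ∫ t' in Set.Ioc 0 t, H (sv s2) (sv s3) t' η := by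
    intro η
    simp only [bilinearSym, Finset.mul_sum, timeOsc, hH, intervalIntegral.integral_of_le ht,
      integral_const_mul]
  have hI : ∀ s2 s3, Integrable fun η => ∫ t' in Set.Ioc 0 t, H s2 s3 t' η := fun s2 s3 =>
    (hprod s2 s3).integral_prod_right
  simp only [hosc]
  refine ⟨integrable_finsetSum _ fun s2 _ => integrable_finsetSum _ fun s3 _ => hI _ _, ?_⟩
  rw [integral_finsetSum _ fun s2 _ => integrable_finsetSum _ fun s3 _ => hI _ _]
  simp only [integral_finsetSum _ fun s3 _ => hI _ _]
  rw [fourier_Gflow ha hφ hA hK h0 hB hK' h0' hs spinorE ht]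
  have hii : ∀ s1 s2 s3, IntervalIntegrable
      (fun t' => duhamelHat A B spinorE s1 s2 s3 t t' ξ) volume 0 t := fun s1 s2 s3 =>
    ((smoothFamily_duhamelHat hA hK h0 hB hK' h0' hs spinorE s1 s2 s3 t).1.continuous.comp
      (continuous_id.prodMk continuous_const)).intervalIntegrable _ _
  simp only [map_sum, ← ContinuousLinearMap.intervalIntegral_comp_comm _ (hii _ _ _)]
  rw [Fintype.sum_bool]
  simp only [sv, if_true, Bool.false_eq_true, if_false, ell_duhamelHat_neg _ _ _ _ hξ,
    intervalIntegral.integral_zero, Finset.sum_const_zero, add_zero, Finset.mul_sum]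
  refine Finset.sum_congr rfl fun s2 _ => Finset.sum_congr rfl fun s3 _ => ?_
  rw [← intervalIntegral.integral_const_mul, intervalIntegral.integral_of_le ht]
  simp only [exp_mul_ell_duhamelHat_pos hA hK h0 hB hK' h0' _ _ _ _ hξ]
  exact integral_integral_swap (hprod _ _)

end ProjectedFlow

section Cutoffs

/-- A closed coordinate rectangle in the plane. -/
def rect (a b c d : ℝ) : Set Rd2 := {ξ | ξ 0 ∈ Set.Icc a b ∧ ξ 1 ∈ Set.Icc c d}

lemma rect_eq_preimage (a b c d : ℝ) :
    rect a b c d = (MeasurableEquiv.toLp 2 (Fin 2 → ℝ)).symm ⁻¹' Set.Icc ![a, c] ![b, d] := by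
  ext ξ
  simp [rect, Set.mem_Icc, Pi.le_def, Fin.forall_fin_two]
  tauto

lemma measurableSet_rect (a b c d : ℝ) : MeasurableSet (rect a b c d) := by
  rw [rect_eq_preimage]
  exact (MeasurableEquiv.measurable _) measurableSet_Icc

lemma volume_rect (a b c d : ℝ) :
    volume (rect a b c d) = ENNReal.ofReal (b - a) * ENNReal.ofReal (d - c) := by
  rw [rect_eq_preimage, (EuclideanSpace.volume_preserving_symm_measurableEquiv_toLp
    (Fin 2)).measure_preimage measurableSet_Icc.nullMeasurableSet, Real.volume_Icc_pi]
  simp [Fin.prod_univ_two]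

lemma isCompact_rect (a b c d : ℝ) : IsCompact (rect a b c d) := by
  have : rect a b c d = (PiLp.homeomorph 2 (fun _ : Fin 2 => ℝ)) ⁻¹' Set.Icc ![a, c] ![b, d] := by
    ext ξ
    simp [rect, Set.mem_Icc, Pi.le_def, Fin.forall_fin_two]
    tauto
  rw [this]
  exact (Homeomorph.isCompact_preimage _).2 isCompact_Icc

/-- A fixed smooth even cutoff on the line. -/
def lineBump : ContDiffBump (0 : ℝ) := ⟨1/8, 1/4, by norm_num, by norm_num⟩

/-- A smooth cutoff adapted to a rectangle of dimensions `r² × r` centred at `(c r², d r)`. -/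
def cutoff (r c d : ℝ) (ξ : Rd2) : ℝ := lineBump (ξ 0 / r ^ 2 - c) * lineBump (ξ 1 / r - d)

lemma cutoff_nonneg (r c d : ℝ) (ξ : Rd2) : 0 ≤ cutoff r c d ξ :=
  mul_nonneg lineBump.nonneg lineBump.nonneg

lemma cutoff_le_one (r c d : ℝ) (ξ : Rd2) : cutoff r c d ξ ≤ 1 :=
  mul_le_one₀ lineBump.le_one lineBump.nonneg lineBump.le_one

lemma contDiff_cutoff (r c d : ℝ) : ContDiff ℝ ∞ (cutoff r c d) := by
  unfold cutoff
  refine (lineBump.contDiff.comp ?_).mul (lineBump.contDiff.comp ?_)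
  · simp only [div_eq_mul_inv]; fun_prop
  · simp only [div_eq_mul_inv]; fun_prop

lemma cutoff_neg (r c d : ℝ) (ξ : Rd2) : cutoff r c d (-ξ) = cutoff r (-c) (-d) ξ := by
  have h0 : (-ξ) 0 / r ^ 2 - c = -(ξ 0 / r ^ 2 - -c) := by simp; ring
  have h1 : (-ξ) 1 / r - d = -(ξ 1 / r - -d) := by simp; ring
  rw [cutoff, h0, h1, ContDiffBump.neg, ContDiffBump.neg, cutoff]

lemma mem_rect_of_cutoff_ne_zero {r c d : ℝ} (hr : 0 < r) {ξ : Rd2} (h : cutoff r c d ξ ≠ 0) :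
    ξ ∈ rect ((c - 1/4) * r ^ 2) ((c + 1/4) * r ^ 2) ((d - 1/4) * r) ((d + 1/4) * r) := by
  have aux : ∀ {x q e : ℝ}, 0 < q → lineBump (x / q - e) ≠ 0 →
      x ∈ Set.Icc ((e - 1/4) * q) ((e + 1/4) * q) := by
    intro x q e hq hx
    have : x / q - e ∈ Function.support lineBump := hx
    rw [lineBump.support_eq, mem_ball_zero_iff, Real.norm_eq_abs, abs_lt] at this
    have h1 := this.1
    have h2 := this.2
    simp only [lineBump] at h1 h2
    constructor
    · rw [← le_div_iff₀ hq]; linarith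
    · rw [← div_le_iff₀ hq]; linarith
  exact ⟨aux (by positivity) (left_ne_zero_of_mul h), aux hr (right_ne_zero_of_mul h)⟩

lemma cutoff_eq_one {r c d : ℝ} (hr : 0 < r) {ξ : Rd2}
    (h : ξ ∈ rect ((c - 1/8) * r ^ 2) ((c + 1/8) * r ^ 2) ((d - 1/8) * r) ((d + 1/8) * r)) :
    cutoff r c d ξ = 1 := by
  have aux : ∀ {x q e : ℝ}, 0 < q → x ∈ Set.Icc ((e - 1/8) * q) ((e + 1/8) * q) →
      lineBump (x / q - e) = 1 := by
    intro x q e hq hx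
    apply lineBump.one_of_mem_closedBall
    rw [mem_closedBall_zero_iff, Real.norm_eq_abs, abs_le]
    simp only [lineBump]
    have h1 := (le_div_iff₀ hq).2 hx.1
    have h2 := (div_le_iff₀ hq).2 hx.2
    constructor <;> linarith
  rw [cutoff, aux (by positivity) h.1, aux hr h.2, one_mul]

lemma smoothFamily_cutoff {r : ℝ} (hr : 0 < r) (c d : ℝ) :
    SmoothFamily (rect ((c - 1/4) * r ^ 2) ((c + 1/4) * r ^ 2) ((d - 1/4) * r) ((d + 1/4) * r))
      (fun _ ξ => (cutoff r c d ξ : ℂ)) := by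
  refine ⟨ofRealCLM.contDiff.comp ((contDiff_cutoff r c d).comp contDiff_snd), fun t ξ hξ => ?_⟩
  rw [ofReal_eq_zero]
  by_contra h
  exact hξ (mem_rect_of_cutoff_ne_zero hr h)

end Cutoffs

section SobolevBlocks

lemma eLpNorm_two_le {E : Type*} [NormedAddCommGroup E] {g : Rd2 → E} {S : Set Rd2}
    (hS : MeasurableSet S) {c V : ℝ} (hc : 0 ≤ c)
    (hV : 0 ≤ V) (h : volume S ≤ ENNReal.ofReal V) (hg : ∀ ξ, ‖g ξ‖ ≤ c)
    (hg0 : ∀ ξ, g ξ ≠ 0 → ξ ∈ S) : eLpNorm g 2 volume ≤ ENNReal.ofReal (c * √V) := by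
  have h1 : eLpNorm g 2 volume ≤ eLpNorm (S.indicator fun _ => c) 2 volume := by
    refine eLpNorm_mono fun ξ => ?_
    by_cases hξ : ξ ∈ S
    · simpa [hξ, abs_of_nonneg hc] using hg ξ
    · simp [not_not.1 (mt (hg0 ξ) hξ)]
  refine h1.trans ?_
  rw [eLpNorm_indicator_const hS (by norm_num) (by norm_num), Real.enorm_of_nonneg hc,
    ENNReal.ofReal_mul hc, Real.sqrt_eq_rpow, ← ENNReal.ofReal_rpow_of_nonneg hV (by norm_num)]
  norm_num
  gcongr

variable {E : Type*} [NormedAddCommGroup E] [NormedSpace ℂ E]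

lemma LPcond_unique {k l : ℕ} {x : ℝ} (hk : LPcond k x) (hl : LPcond l x) : k = l := by
  have key : ∀ {k l : ℕ}, LPcond k x → LPcond l x → k ≤ l := by
    intro k l hk hl
    by_contra! h
    have hk0 : k ≠ 0 := by omega
    have h1 : x < 2 ^ (l + 1) := by
      by_cases hl0 : l = 0
      · simpa [LPcond, hl0] using hl
      · exact (by simpa [LPcond, hl0] using hl : _ ∧ _).2
    have h2 : (2:ℝ) ^ k ≤ x := (by simpa [LPcond, hk0] using hk : _ ∧ _).1
    have h3 : (2:ℝ) ^ (l + 1) ≤ 2 ^ k := pow_le_pow_right₀ one_le_two h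
    linarith
  exact le_antisymm (key hk hl) (key hl hk)

lemma mem_LPset_of_coord {k : ℕ} (hk : k ≠ 0) {ξ : Rd2} (h0 : (2:ℝ) ^ k ≤ |ξ 0|)
    (h1 : ξ 0 ^ 2 + ξ 1 ^ 2 < (2 ^ (k + 1)) ^ 2) : ξ ∈ LPset k := by
  simp only [LPset, LPcond, hk, if_false, Set.mem_ofPred_eq]
  refine ⟨h0.trans (PiLp.norm_apply_le ξ 0), lt_of_pow_lt_pow_left₀ 2 (by positivity) ?_⟩
  rwa [norm_sq_eq]

lemma sobNorm_block_rpow (s : ℝ) (k : ℕ) (M : ℝ) :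
    ((2:ℝ≥0∞) ^ (2 * s * (k:ℝ)) * ENNReal.ofReal M ^ 2) ^ (1/2 : ℝ) =
      ENNReal.ofReal (2 ^ (s * k) * M) := by
  rw [ENNReal.mul_rpow_of_nonneg _ _ (by norm_num), ← ENNReal.rpow_mul,
    ← ENNReal.rpow_natCast (ENNReal.ofReal M), ← ENNReal.rpow_mul,
    ENNReal.ofReal_mul (by positivity), ← ENNReal.ofReal_rpow_of_pos two_pos]
  norm_num
  ring_nf

lemma sobNorm_le_of_forall_mem_LPset (s : ℝ) {f : Rd2 → E} {k : ℕ}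
    (h : ∀ ξ, 𝓕 f ξ ≠ 0 → ξ ∈ LPset k) {M : ℝ}
    (hf : eLpNorm (𝓕 f) 2 volume ≤ ENNReal.ofReal M) :
    sobNorm s f ≤ ENNReal.ofReal (2 ^ (s * k) * M) := by
  rw [sobNorm, tsum_eq_single k]
  · rw [← sobNorm_block_rpow s k M]
    gcongr
    exact (eLpNorm_indicator_le _).trans hf
  · intro l hl
    have : (LPset l).indicator (𝓕 f) = 0 := by
      funext ξ
      refine Set.indicator_apply_eq_zero.2 ?_
      intro hm
      by_contra h0
      exact hl (LPcond_unique hm (h ξ h0))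
    simp [LPnorm, this]

lemma le_sobNorm_of_le_LPnorm (s : ℝ) {f : Rd2 → E} {k : ℕ} {M : ℝ}
    (hf : ENNReal.ofReal M ≤ LPnorm k f) :
    ENNReal.ofReal (2 ^ (s * k) * M) ≤ sobNorm s f := by
  rw [← sobNorm_block_rpow s k M, sobNorm]
  gcongr
  calc (2:ℝ≥0∞) ^ (2 * s * (k:ℝ)) * ENNReal.ofReal M ^ 2
      ≤ (2:ℝ≥0∞) ^ (2 * s * (k:ℝ)) * LPnorm k f ^ 2 := by gcongr
    _ ≤ _ := ENNReal.le_tsum (f := fun k : ℕ => (2:ℝ≥0∞) ^ (2 * s * (k:ℝ)) * LPnorm k f ^ 2) k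

lemma eLpNorm_indicator_const_two {S : Set Rd2} (hS : MeasurableSet S) {c V : ℝ} (hc : 0 ≤ c)
    (hV : 0 ≤ V) (h : volume S = ENNReal.ofReal V) :
    eLpNorm (S.indicator fun _ => c) 2 volume = ENNReal.ofReal (c * √V) := by
  rw [eLpNorm_indicator_const hS (by norm_num) (by norm_num), h,
    ENNReal.ofReal_mul hc, Real.sqrt_eq_rpow, ENNReal.ofReal_rpow_of_nonneg hV (by norm_num),
    Real.enorm_of_nonneg hc]
  norm_num

lemma le_LPnorm_of_le {f : Rd2 → E} {k : ℕ} {S : Set Rd2} (hS : MeasurableSet S)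
    (hSk : S ⊆ LPset k) {c V : ℝ} (hc : 0 ≤ c) (hV : 0 ≤ V) (h : volume S = ENNReal.ofReal V)
    (hf : ∀ ξ ∈ S, c ≤ ‖𝓕 f ξ‖) : ENNReal.ofReal (c * √V) ≤ LPnorm k f := by
  rw [← eLpNorm_indicator_const_two hS hc hV h, LPnorm]
  refine eLpNorm_mono fun ξ => ?_
  by_cases hξ : ξ ∈ S
  · simpa [hξ, hSk hξ, abs_of_nonneg hc] using hf ξ hξ
  · simp [hξ]

end SobolevBlocks

section Counterexample

/-- The rectangle carrying `cutoff r c d`. -/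
def cutoffRect (r c d : ℝ) : Set Rd2 :=
  rect ((c - 1/4) * r ^ 2) ((c + 1/4) * r ^ 2) ((d - 1/4) * r) ((d + 1/4) * r)

/-- The Fourier transform of the gauge datum. -/
def gaugeDatumHat (r : ℝ) (η : Rd2) : ℂ :=
  (cutoff r (5/4) (3/4) η : ℂ) + (cutoff r (-(5/4)) (-(3/4)) η : ℂ)

/-- The Fourier transform of the scalar profile of the spinor datum. -/
def spinorDatumHat (r : ℝ) (ζ : Rd2) : ℂ := (cutoff r (13/4) (-(3/4)) ζ : ℂ)

/-- The real-valued gauge datum. -/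
def gaugeDatum (r : ℝ) (x : Rd2) : ℝ := (𝓕⁻ (gaugeDatumHat r) x).re

/-- The support of `gaugeDatumHat`. -/
def gaugeRect (r : ℝ) : Set Rd2 := cutoffRect r (5/4) (3/4) ∪ cutoffRect r (-(5/4)) (-(3/4))

/-- The set of output frequencies on which the flow derivative is large. -/
def outputRect (r : ℝ) : Set Rd2 :=
  rect ((9/2 - 1/16) * r ^ 2) ((9/2 + 1/16) * r ^ 2) (-(1/16) * r) (1/16 * r)

variable {r : ℝ}

lemma smoothFamily_gaugeDatumHat (hr : 0 < r) :
    SmoothFamily (gaugeRect r) fun _ => gaugeDatumHat r := by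
  have h1 := smoothFamily_cutoff hr (5/4) (3/4)
  have h2 := smoothFamily_cutoff hr (-(5/4)) (-(3/4))
  refine ⟨h1.1.add h2.1, fun t ξ hξ => ?_⟩
  exact (congrArg₂ (· + ·) (h1.2 t ξ fun h => hξ (Or.inl h))
    (h2.2 t ξ fun h => hξ (Or.inr h))).trans (add_zero 0)

lemma isCompact_gaugeRect (r : ℝ) : IsCompact (gaugeRect r) :=
  (isCompact_rect _ _ _ _).union (isCompact_rect _ _ _ _)

lemma ofReal_gaugeDatum (r : ℝ) (x : Rd2) :
    ((gaugeDatum r x : ℝ) : ℂ) = 𝓕⁻ (gaugeDatumHat r) x := by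
  rw [gaugeDatum, ← conj_eq_iff_re, Real.fourierInv_eq', ← integral_conj, ← integral_neg_eq_self]
  refine integral_congr_ae (Filter.Eventually.of_forall fun η => ?_)
  have h : gaugeDatumHat r (-η) = gaugeDatumHat r η := by
    simp only [gaugeDatumHat, cutoff_neg, neg_neg]
    ring
  simp only [h, smul_eq_mul, map_mul, ← exp_conj, conj_ofReal, conj_I]
  congr 1
  · congr 1
    simp
  · simp [gaugeDatumHat]

lemma fourier_gaugeDatum (hr : 0 < r) :
    𝓕 (fun x => ((gaugeDatum r x : ℝ) : ℂ)) = gaugeDatumHat r := by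
  simp only [ofReal_gaugeDatum]
  exact (smoothFamily_gaugeDatumHat hr).fourier_fourierInv (isCompact_gaugeRect r) 0

lemma fourier_spinorDatum (hr : 0 < r) :
    𝓕 (𝓕⁻ (spinorDatumHat r)) = spinorDatumHat r :=
  (smoothFamily_cutoff hr (13/4) (-(3/4))).fourier_fourierInv (isCompact_rect _ _ _ _) 0

lemma zero_notMem_gaugeRect (hr : 0 < r) : (0 : Rd2) ∉ gaugeRect r := by
  have := pow_pos hr 2
  rintro (⟨⟨h1, h2⟩, -⟩ | ⟨⟨h1, h2⟩, -⟩) <;> simp only [PiLp.zero_apply] at h1 h2 <;> linarith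

lemma zero_notMem_cutoffRect (hr : 0 < r) : (0 : Rd2) ∉ cutoffRect r (13/4) (-(3/4)) := by
  have := pow_pos hr 2
  rintro ⟨⟨h1, h2⟩, -⟩
  simp only [PiLp.zero_apply] at h1 h2
  linarith

lemma zero_notMem_gaugeRect_add (hr : 0 < r) :
    (0 : Rd2) ∉ gaugeRect r + cutoffRect r (13/4) (-(3/4)) := by
  have := pow_pos hr 2
  rintro ⟨η, hη, ζ, ⟨⟨h1, -⟩, -⟩, h⟩
  have h0 : η 0 + ζ 0 = 0 := by simpa using congrArg (fun f : Rd2 => f 0) h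
  rcases hη with ⟨⟨h3, -⟩, -⟩ | ⟨⟨h3, -⟩, -⟩ <;> linarith

lemma volume_outputRect (r : ℝ) : volume (outputRect r) = ENNReal.ofReal (r ^ 3 / 64) := by
  rw [outputRect, volume_rect, ← ENNReal.ofReal_mul (by nlinarith [sq_nonneg r])]
  congr 1
  ring

lemma norm_ell_fourier_Gflow_lower {t : ℝ} (ht : 0 < t) (ht1 : t ≤ 1) (hr : 5 ≤ r)
    (hrt : 384 ≤ r * t) {ξ : Rd2} (hξ : ξ ∈ outputRect r) :
    t * r ^ 2 / 8192 ≤ ‖ell ξ (𝓕 (Gflow (fun x => ((gaugeDatum r x : ℝ) : ℂ))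
      (fun x => 𝓕⁻ (spinorDatumHat r) x • spinorE) t) ξ)‖ := by
  have hr0 : 0 < r := by linarith
  have hr2 : 0 < r ^ 2 := pow_pos hr0 2
  obtain ⟨⟨hξ0, hξ0'⟩, ⟨hξ1, hξ1'⟩⟩ := hξ
  have hne : ξ ≠ 0 := by
    rintro rfl
    simp only [PiLp.zero_apply] at hξ0
    linarith
  obtain ⟨hInt, heq⟩ := exp_mul_ell_fourier_Gflow (fourier_gaugeDatum hr0)
    (fourier_spinorDatum hr0) (smoothFamily_gaugeDatumHat hr0) (isCompact_gaugeRect r)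
    (zero_notMem_gaugeRect hr0) (smoothFamily_cutoff hr0 (13/4) (-(3/4)))
    (isCompact_rect _ _ _ _) (zero_notMem_cutoffRect hr0) (zero_notMem_gaugeRect_add hr0)
    ht.le hne
  set F : Rd2 → ℂ := fun η => gaugeDatumHat r η * spinorDatumHat r (ξ - η) * bilinearSym t ξ η
    with hF
  set w : Rd2 → ℝ := fun η => cutoff r (5/4) (3/4) η * cutoff r (13/4) (-(3/4)) (ξ - η) with hw
  have hw0 : ∀ η, 0 ≤ w η := fun η => mul_nonneg (cutoff_nonneg _ _ _ _) (cutoff_nonneg _ _ _ _)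
  have hFw : ∀ η, F η = w η * bilinearSym t ξ η := by
    intro η
    have : cutoff r (-(5/4)) (-(3/4)) η * cutoff r (13/4) (-(3/4)) (ξ - η) = 0 := by
      by_contra h
      obtain ⟨⟨-, h1⟩, -⟩ := mem_rect_of_cutoff_ne_zero hr0 (left_ne_zero_of_mul h)
      obtain ⟨⟨-, h2⟩, -⟩ := mem_rect_of_cutoff_ne_zero hr0 (right_ne_zero_of_mul h)
      simp only [PiLp.sub_apply] at h2
      linarith
    have hc : (cutoff r (-(5/4)) (-(3/4)) η : ℂ) * (cutoff r (13/4) (-(3/4)) (ξ - η) : ℂ) = 0 := by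
      exact_mod_cast this
    simp only [hF, hw, gaugeDatumHat, spinorDatumHat]
    push_cast
    linear_combination bilinearSym t ξ η * hc
  have hlow : ∀ η, t / (128 * r) * w η ≤ -(F η).im := by
    intro η
    have him : (F η).im = w η * (bilinearSym t ξ η).im := by rw [hFw, im_ofReal_mul]
    rw [him]
    by_cases h : w η = 0
    · simp [h]
    · obtain ⟨⟨h1, h2⟩, ⟨h3, h4⟩⟩ := mem_rect_of_cutoff_ne_zero hr0 (left_ne_zero_of_mul h)
      obtain ⟨⟨h5, h6⟩, ⟨h7, h8⟩⟩ := mem_rect_of_cutoff_ne_zero hr0 (right_ne_zero_of_mul h)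
      have := bilinearSym_lower ht ht1 hr hrt (add_sub_cancel η ξ).symm
        ⟨by linarith, by linarith⟩ ⟨by linarith, by linarith⟩
        ⟨by linarith, by linarith⟩ ⟨by linarith, by linarith⟩
      linarith [mul_le_mul_of_nonneg_left this (hw0 η)]
  set Q : Set Rd2 := rect ((5/4 - 1/16) * r ^ 2) ((5/4 + 1/16) * r ^ 2) ((3/4 - 1/16) * r)
    ((3/4 + 1/16) * r) with hQ
  have hwQ : ∀ η ∈ Q, w η = 1 := by
    rintro η ⟨⟨h1, h2⟩, ⟨h3, h4⟩⟩
    have e1 : cutoff r (5/4) (3/4) η = 1 :=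
      cutoff_eq_one hr0 ⟨⟨by linarith, by linarith⟩, ⟨by linarith, by linarith⟩⟩
    have e2 : cutoff r (13/4) (-(3/4)) (ξ - η) = 1 := by
      refine cutoff_eq_one hr0 ⟨⟨?_, ?_⟩, ⟨?_, ?_⟩⟩ <;> simp only [PiLp.sub_apply] <;> linarith
    simp only [hw, e1, e2, mul_one]
  have hQv : volume Q = ENNReal.ofReal (r ^ 3 / 64) := by
    rw [hQ, volume_rect, ← ENNReal.ofReal_mul (by linarith)]
    congr 1
    ring
  have hQm : MeasurableSet Q := measurableSet_rect _ _ _ _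
  have hmain : t * r ^ 2 / 8192 ≤ ∫ η, -(F η).im := by
    calc t * r ^ 2 / 8192 = ∫ η, Q.indicator (fun _ => t / (128 * r)) η := by
          rw [integral_indicator_const _ hQm, measureReal_def, hQv,
            ENNReal.toReal_ofReal (by positivity), smul_eq_mul]
          field_simp
          norm_num
      _ ≤ ∫ η, -(F η).im := by
          refine integral_mono ?_ hInt.im.neg fun η => ?_
          · exact (integrable_indicator_iff hQm).2 (integrableOn_const (by simp [hQv]))
          · by_cases hη : η ∈ Q
            · simpa [hη, hwQ η hη] using hlow η
            · have := mul_nonneg (by positivity : 0 ≤ t / (128 * r)) (hw0 η)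
              simpa [hη] using this.trans (hlow η)
  have him : ∫ η, -(F η).im = -(∫ η, F η).im := by
    rw [integral_neg]
    congr 1
    exact integral_im hInt
  have hnorm : ‖cexp (I * ((t * ‖ξ‖ : ℝ) : ℂ))‖ = 1 := by rw [mul_comm, norm_exp_ofReal_mul_I]
  have := congrArg norm heq
  rw [norm_mul, hnorm, one_mul] at this
  rw [this]
  rw [him] at hmain
  exact hmain.trans ((neg_le_abs _).trans (abs_im_le_norm _))

/-- The spinor-valued datum. -/
def spinorDatum (r : ℝ) (x : Rd2) : Spinor := 𝓕⁻ (spinorDatumHat r) x • spinorE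

lemma fourier_spinorDatum_vec (hr : 0 < r) (ξ : Rd2) :
    𝓕 (spinorDatum r) ξ = spinorDatumHat r ξ • spinorE := by
  have := fourier_smul_vec (𝓕⁻ (spinorDatumHat r)) spinorE ξ
  rwa [fourier_spinorDatum hr] at this

lemma norm_cutoff_le (r c d : ℝ) (ξ : Rd2) : ‖(cutoff r c d ξ : ℂ)‖ ≤ 1 := by
  rw [norm_real, Real.norm_of_nonneg (cutoff_nonneg _ _ _ _)]
  exact cutoff_le_one _ _ _ _

lemma volume_cutoffRect (r c d : ℝ) :
    volume (cutoffRect r c d) = ENNReal.ofReal (r ^ 3 / 4) := by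
  rw [cutoffRect, volume_rect, ← ENNReal.ofReal_mul (by nlinarith [sq_nonneg r])]
  congr 1
  ring

lemma sobNorm_gaugeDatum_le (s : ℝ) {j : ℕ} (hj : j ≠ 0) (hr : 5 ≤ r) (hrj : r = 2 ^ j) :
    sobNorm s (fun x => ((gaugeDatum r x : ℝ) : ℂ)) ≤
      ENNReal.ofReal (2 ^ (s * (2 * j : ℕ)) * (2 * √(r ^ 3))) := by
  have hr0 : 0 < r := by linarith
  have hsupp : ∀ ξ, gaugeDatumHat r ξ ≠ 0 → ξ ∈ gaugeRect r := fun ξ h =>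
    not_not.1 (mt ((smoothFamily_gaugeDatumHat hr0).2 0 ξ) h)
  refine sobNorm_le_of_forall_mem_LPset s (fun ξ h => ?_) ?_
  · rw [fourier_gaugeDatum hr0] at h
    have e1 : (2:ℝ) ^ (2 * j) = r ^ 2 := by rw [hrj]; ring
    have e2 : (2:ℝ) ^ (2 * j + 1) = 2 * r ^ 2 := by rw [hrj]; ring
    have hr2 : 25 ≤ r ^ 2 := by nlinarith
    have hr4 : r ^ 2 * 25 ≤ r ^ 2 * r ^ 2 := by gcongr
    have h0 : r ^ 2 ≤ |ξ 0| ∧ |ξ 0| ≤ 3 / 2 * r ^ 2 ∧ |ξ 1| ≤ r := by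
      rcases hsupp ξ h with ⟨⟨h1, h2⟩, ⟨h3, h4⟩⟩ | ⟨⟨h1, h2⟩, ⟨h3, h4⟩⟩
      · exact ⟨le_abs.2 (Or.inl (by linarith)), abs_le.2 ⟨by linarith, by linarith⟩,
          abs_le.2 ⟨by linarith, by linarith⟩⟩
      · exact ⟨le_abs.2 (Or.inr (by linarith)), abs_le.2 ⟨by linarith, by linarith⟩,
          abs_le.2 ⟨by linarith, by linarith⟩⟩
    refine mem_LPset_of_coord (by omega) (e1 ▸ h0.1) ?_
    rw [e2, ← sq_abs (ξ 0), ← sq_abs (ξ 1)]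
    have h5 := pow_le_pow_left₀ (abs_nonneg _) h0.2.1 2
    have h6 := pow_le_pow_left₀ (abs_nonneg _) h0.2.2 2
    nlinarith only [h5, h6, hr4, hr2]
  · rw [fourier_gaugeDatum hr0]
    refine eLpNorm_two_le (isCompact_gaugeRect r).measurableSet (by norm_num) (by positivity) ?_
      (fun ξ => ?_) hsupp
    · refine (measure_union_le _ _).trans ?_
      rw [volume_cutoffRect, volume_cutoffRect, ← ENNReal.ofReal_add (by positivity) (by positivity)]
      apply ENNReal.ofReal_le_ofReal
      linarith [pow_pos hr0 3]
    · refine (norm_add_le _ _).trans ?_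
      linarith [norm_cutoff_le r (5/4) (3/4) ξ, norm_cutoff_le r (-(5/4)) (-(3/4)) ξ]

lemma sobNorm_spinorDatum_le (s : ℝ) {j : ℕ} (hr : 5 ≤ r) (hrj : r = 2 ^ j) :
    sobNorm s (spinorDatum r) ≤
      ENNReal.ofReal (2 ^ (s * (2 * j + 1 : ℕ)) * (1 * √(r ^ 3))) := by
  have hr0 : 0 < r := by linarith
  have hsupp : ∀ ξ, 𝓕 (spinorDatum r) ξ ≠ 0 → ξ ∈ cutoffRect r (13/4) (-(3/4)) := by
    intro ξ h
    rw [fourier_spinorDatum_vec hr0] at h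
    exact not_not.1 (mt ((smoothFamily_cutoff hr0 (13/4) (-(3/4))).2 0 ξ)
      (left_ne_zero_of_smul h))
  refine sobNorm_le_of_forall_mem_LPset s (fun ξ h => ?_) ?_
  · have e1 : (2:ℝ) ^ (2 * j + 1) = 2 * r ^ 2 := by rw [hrj]; ring
    have e2 : (2:ℝ) ^ (2 * j + 1 + 1) = 4 * r ^ 2 := by rw [hrj]; ring
    have hr2 : 25 ≤ r ^ 2 := by nlinarith
    have hr4 : r ^ 2 * 25 ≤ r ^ 2 * r ^ 2 := by gcongr
    obtain ⟨⟨h1, h2⟩, ⟨h3, h4⟩⟩ := hsupp ξ h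
    refine mem_LPset_of_coord (by omega) (e1 ▸ le_abs.2 (Or.inl (by linarith))) ?_
    have h5 : ξ 0 ^ 2 ≤ (7 / 2 * r ^ 2) ^ 2 :=
      sq_le_sq' (by linarith) (by linarith)
    have h6 : ξ 1 ^ 2 ≤ r ^ 2 := sq_le_sq' (by linarith) (by linarith)
    rw [e2]
    nlinarith only [h5, h6, hr4, hr2]
  · refine eLpNorm_two_le (measurableSet_rect _ _ _ _) zero_le_one (by positivity) ?_
      (fun ξ => ?_) hsupp
    · change volume (cutoffRect r (13/4) (-(3/4))) ≤ _
      rw [volume_cutoffRect]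
      apply ENNReal.ofReal_le_ofReal
      linarith [pow_pos hr0 3]
    · rw [fourier_spinorDatum_vec hr0, norm_smul, spinorE, PiLp.norm_single, norm_one,
        mul_one]
      exact norm_cutoff_le _ _ _ _

lemma le_sobNorm_Gflow (s : ℝ) {j : ℕ} {t : ℝ} (ht : 0 < t) (ht1 : t ≤ 1) (hr : 5 ≤ r)
    (hrt : 384 ≤ r * t) (hrj : r = 2 ^ j) :
    ENNReal.ofReal (2 ^ (s * (2 * j + 2 : ℕ)) * (t * r ^ 2 / 16384 * √(r ^ 3 / 64))) ≤
      sobNorm s (Gflow (fun x => ((gaugeDatum r x : ℝ) : ℂ)) (spinorDatum r) t) := by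
  have hr0 : 0 < r := by linarith
  refine le_sobNorm_of_le_LPnorm s (le_LPnorm_of_le (S := outputRect r)
    (measurableSet_rect _ _ _ _) ?_ (by positivity) (by positivity) (volume_outputRect r) ?_)
  · have e1 : (2:ℝ) ^ (2 * j + 2) = 4 * r ^ 2 := by rw [hrj]; ring
    have e2 : (2:ℝ) ^ (2 * j + 2 + 1) = 8 * r ^ 2 := by rw [hrj]; ring
    have hr2 : 25 ≤ r ^ 2 := by nlinarith
    have hr4 : r ^ 2 * 25 ≤ r ^ 2 * r ^ 2 := by gcongr
    rintro ξ ⟨⟨h1, h2⟩, ⟨h3, h4⟩⟩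
    refine mem_LPset_of_coord (by omega) (e1 ▸ le_abs.2 (Or.inl (by linarith))) ?_
    have h5 : ξ 0 ^ 2 ≤ (5 * r ^ 2) ^ 2 :=
      sq_le_sq' (by linarith) (by linarith)
    have h6 : ξ 1 ^ 2 ≤ r ^ 2 := sq_le_sq' (by linarith) (by linarith)
    rw [e2]
    nlinarith only [h5, h6, hr4, hr2]
  · intro ξ hξ
    have h1 := norm_ell_fourier_Gflow_lower ht ht1 hr hrt hξ
    have h2 := norm_ell_le ξ (𝓕 (Gflow (fun x => ((gaugeDatum r x : ℝ) : ℂ)) (spinorDatum r) t) ξ)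
    have h3 := h1.trans h2
    linarith

/-- The power of the frequency scale lost by the bilinear estimate. -/
lemma loss_of_bound {s C t : ℝ} {j : ℕ} (ht : 0 < t) (hr0 : 0 < r) (hrj : r = 2 ^ j)
    (h : (2:ℝ) ^ (s * (2 * j + 2 : ℕ)) * (t * r ^ 2 / 16384 * √(r ^ 3 / 64)) ≤
      C * (2 ^ (s * (2 * j : ℕ)) * (2 * √(r ^ 3))) *
        (2 ^ (s * (2 * j + 1 : ℕ)) * (1 * √(r ^ 3)))) :
    r ^ (1 / 2 - 2 * s) ≤ 262144 * C * (2:ℝ) ^ (-s) / t := by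
  have h64 : √(r ^ 3 / 64) = √(r ^ 3) / 8 := by
    rw [Real.sqrt_div (by positivity)]
    congr 1
    rw [show (64:ℝ) = 8 ^ 2 by norm_num, Real.sqrt_sq (by norm_num)]
  have hsq : √(r ^ 3) = r * r ^ (1/2 : ℝ) := by
    rw [show r ^ 3 = r ^ 2 * r by ring, Real.sqrt_mul (by positivity), Real.sqrt_sq hr0.le,
      Real.sqrt_eq_rpow]
  have hhalf : r ^ (1/2 : ℝ) * r ^ (1/2 : ℝ) = r := by
    rw [← Real.rpow_add hr0]; norm_num
  have hrs : r ^ (2 * s) = (2:ℝ) ^ (s * (2 * j : ℕ)) := by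
    rw [hrj, ← Real.rpow_natCast, ← Real.rpow_mul two_pos.le]
    congr 1
    push_cast
    ring
  have e2 : (2:ℝ) ^ (s * (2 * j + 2 : ℕ)) = r ^ (2 * s) * 2 ^ s * 2 ^ s := by
    rw [hrs, ← Real.rpow_add two_pos, ← Real.rpow_add two_pos]
    congr 1
    push_cast
    ring
  have e1 : (2:ℝ) ^ (s * (2 * j + 1 : ℕ)) = r ^ (2 * s) * 2 ^ s := by
    rw [hrs, ← Real.rpow_add two_pos]
    congr 1
    push_cast
    ring
  rw [h64, hsq, e1, e2, ← hrs] at h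
  have hX : 0 < r ^ (2 * s) := by positivity
  have hY : 0 < (2:ℝ) ^ s := by positivity
  have hZ : 0 < r ^ (1/2 : ℝ) := by positivity
  rw [Real.rpow_sub hr0, Real.rpow_neg two_pos.le]
  set X := r ^ (2 * s)
  set Y := (2:ℝ) ^ s
  set Z := r ^ (1/2 : ℝ)
  have h' : (X * Y * r ^ 3) * (t * Y * Z) ≤ (X * Y * r ^ 3) * (262144 * C * X) := by
    have : C * (X * (2 * (r * Z))) * (X * Y * (1 * (r * Z))) = 2 * C * X * X * Y * r ^ 3 := by
      linear_combination 2 * C * X * X * Y * r ^ 2 * hhalf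
    rw [this] at h
    linarith
  have h'' := le_of_mul_le_mul_left h' (by positivity)
  rw [div_le_div_iff₀ hX ht, mul_assoc (262144 * C), inv_mul_eq_div, mul_div_assoc',
    le_div_iff₀ hY]
  linarith

end Counterexample

/-- **Failure of the bilinear estimate for the second derivative of the spinor flow.**
For `s < 1/4` and `T > 0` there is no constant `C` with
`sup_{0≤t≤T} ‖G(t)‖_{H^s} ≤ C ‖a₀‖_{H^s} ‖ψ₀‖_{H^s}` for all real-valued
`a₀ ∈ H^s(ℝ²;ℝ)` and all `ψ₀ ∈ H^s(ℝ²;ℂ²)`. -/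
theorem failure_bilinear_estimate_spinor_flow (s : ℝ) (hs : s < 1/4) (T : ℝ) (hT : 0 < T) :
    ¬ ∃ C : ℝ, ∀ (a0 : Rd2 → ℝ) (ψ0 : Rd2 → Spinor),
      sobNorm s (fun x => ((a0 x : ℝ) : ℂ)) ≠ ⊤ → sobNorm s ψ0 ≠ ⊤ →
      ∀ t ∈ Set.Icc (0:ℝ) T,
        sobNorm s (Gflow (fun x => ((a0 x : ℝ) : ℂ)) ψ0 t)
          ≤ ENNReal.ofReal C * sobNorm s (fun x => ((a0 x : ℝ) : ℂ)) * sobNorm s ψ0 := by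
  rintro ⟨C, hC⟩
  set t := min T 1 with ht_def
  have ht : 0 < t := lt_min hT one_pos
  have hpow : Filter.Tendsto (fun j : ℕ => (2:ℝ) ^ j) Filter.atTop Filter.atTop :=
    tendsto_pow_atTop_atTop_of_one_lt one_lt_two
  have hgrow := (tendsto_rpow_atTop (by linarith : 0 < 1 / 2 - 2 * s)).comp hpow
  obtain ⟨j, hj, h5, h384, hbig⟩ := ((Filter.eventually_ne_atTop 0).and
    ((hpow.eventually_ge_atTop 5).and ((hpow.eventually_ge_atTop (384 / t)).and
      (hgrow.eventually_gt_atTop (262144 * C * (2:ℝ) ^ (-s) / t))))).exists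
  set r : ℝ := 2 ^ j with hr_def
  have ha := sobNorm_gaugeDatum_le s hj h5 hr_def
  have hψ := sobNorm_spinorDatum_le s h5 hr_def
  have hG := le_sobNorm_Gflow s ht (min_le_right _ _) h5 ((div_le_iff₀ ht).1 h384) hr_def
  have hbound := hC (gaugeDatum r) (spinorDatum r) (ne_top_of_le_ne_top ENNReal.ofReal_ne_top ha)
    (ne_top_of_le_ne_top ENNReal.ofReal_ne_top hψ) t ⟨ht.le, min_le_left _ _⟩
  have hchain := hG.trans (hbound.trans (mul_le_mul' (mul_le_mul' le_rfl ha) hψ))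
  have hr0 : 0 < r := by positivity
  rw [← ENNReal.ofReal_mul' (by positivity), ← ENNReal.ofReal_mul' (by positivity)] at hchain
  rcases ENNReal.ofReal_le_ofReal_iff'.1 hchain with h | h
  · exact absurd hbig (not_lt.2 (loss_of_bound ht hr0 hr_def h))
  · exact absurd h (not_le.2 (by positivity))

end
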